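/- arXiv:1005.0247 — 2 statements merged into one kernel-verified Lean document; each statement's English description precedes it below -/
import Mathlib

section
/- Let n ≥ 2, let K : 𝔹ⁿ → [0,∞] be a measurable function, let Φ : [0,∞] → [0,∞] be a non-decreasing convex function, and let p ∈ (0,∞). Then ∫₀¹ dr/(r·k(r)^{1/p}) ≥ (1/n) · ∫_{eM}^{∞} dτ/(τ·[Φ⁻¹(τ)]^{1/p}), where k(r) is the average of K over the sphere |x| = r, M = (1/Ω_n)·∫_{𝔹ⁿ} Φ(K(x)) dm(x) is the mean value of Φ∘K over the unit ball, and both sides are interpreted with the conventions a/∞ = 0 and a/0 = ∞ for a > 0. -/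
open MeasureTheory Metric Set
open scoped ENNReal NNReal

/-- The generalized inverse `Φ⁻¹(τ) = inf{ t : Φ(t) ≥ τ }` of a non-decreasing
function `Φ : [0,∞] → [0,∞]` (with `inf ∅ = ∞`). -/
noncomputable def genInv (Φ : ℝ≥0∞ → ℝ≥0∞) (τ : ℝ≥0∞) : ℝ≥0∞ :=
  sInf {t : ℝ≥0∞ | τ ≤ Φ t}

/-- The average `k(r)` of `K : 𝔹ⁿ → [0,∞]` over the sphere `|x| = r` with respect
to the `(n-1)`-dimensional surface (Hausdorff) measure. -/
noncomputable def sphereAvg (n : ℕ) (K : EuclideanSpace ℝ (Fin n) → ℝ≥0∞) (r : ℝ) : ℝ≥0∞ :=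
  (∫⁻ x in Metric.sphere (0 : EuclideanSpace ℝ (Fin n)) r, K x ∂(μH[(n : ℝ) - 1])) /
    μH[(n : ℝ) - 1] (Metric.sphere (0 : EuclideanSpace ℝ (Fin n)) r)


/-- Two uniformly distributed probability measures agree on balls. -/
theorem measure_ball_eq_of_forall_measure_ball_eq {X : Type*} [PseudoMetricSpace X]
    [SecondCountableTopology X] [MeasurableSpace X] [BorelSpace X] {μ ν : Measure X}
    [IsProbabilityMeasure μ] [IsProbabilityMeasure ν]
    (hμ : ∀ x y : X, ∀ r, μ (ball x r) = μ (ball y r))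
    (hν : ∀ x y : X, ∀ r, ν (ball x r) = ν (ball y r)) (x : X) (r : ℝ) :
    μ (ball x r) = ν (ball x r) := by
  have hs : MeasurableSet {p : X × X | dist p.1 p.2 < r} :=
    (isOpen_lt continuous_dist continuous_const).measurableSet
  have h₁ := Measure.prod_apply (μ := μ) (ν := ν) hs
  have h₂ := Measure.prod_apply_symm (μ := μ) (ν := ν) hs
  have e₁ : ∀ y : X, Prod.mk y ⁻¹' {p : X × X | dist p.1 p.2 < r} = ball y r := by
    intro y; ext z; simp [dist_comm]
  have e₂ : ∀ y : X, (fun z => (z, y)) ⁻¹' {p : X × X | dist p.1 p.2 < r} = ball y r := by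
    intro y; ext z; simp
  simp only [e₁, hν _ x, lintegral_const, measure_univ, mul_one] at h₁
  simp only [e₂, hμ _ x, lintegral_const, measure_univ, mul_one] at h₂
  rw [← h₂, h₁]

theorem measure_isOpen_le_of_forall_measure_ball_eq {X : Type*} [PseudoMetricSpace X]
    [SecondCountableTopology X] [MeasurableSpace X] [BorelSpace X] {μ ν : Measure X}
    [IsProbabilityMeasure μ] [IsProbabilityMeasure ν]
    (hμ : ∀ x y : X, ∀ r, μ (ball x r) = μ (ball y r))
    (hν : ∀ x y : X, ∀ r, ν (ball x r) = ν (ball y r)) {U : Set X} (hU : IsOpen U) :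
    μ U ≤ ν U := by
  have hne : Nonempty X := by
    by_contra h
    rw [not_nonempty_iff] at h
    simpa [univ_eq_empty_iff.2 h] using (measure_univ (μ := μ)).symm
  obtain ⟨o⟩ := hne
  let V : ℕ → Set X := fun j => {x | ball x (1 / ((j : ℝ) + 1)) ⊆ U}
  have hVmono : Monotone V := fun i j hij x (hx : _ ⊆ U) =>
    (ball_subset_ball (by gcongr)).trans hx
  have hVU : ⋃ j, V j = U := by
    ext x
    simp only [mem_iUnion]
    constructor
    · rintro ⟨j, hj⟩
      exact hj (mem_ball_self (by positivity))
    · intro hx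
      obtain ⟨ε, hε, h⟩ := Metric.isOpen_iff.1 hU x hx
      obtain ⟨j, hj⟩ := exists_nat_one_div_lt hε
      exact ⟨j, (ball_subset_ball hj.le).trans h⟩
  rw [← hVU, hVmono.measure_iUnion, hVU]
  refine iSup_le fun j => ?_
  set r : ℝ := 1 / ((j : ℝ) + 1) with hr
  have hrpos : 0 < r := by positivity
  set h : ℝ≥0∞ := ν (ball o r) with hh
  have hh0 : h ≠ 0 := by
    intro h0
    obtain ⟨c, hc, hcover⟩ := TopologicalSpace.isOpen_iUnion_countable
      (fun x : X => ball x r) fun _ => isOpen_ball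
    have : ν (⋃ x ∈ c, ball x r) = 0 :=
      (measure_biUnion_null_iff hc).2 fun x _ => by rw [hν x o, ← hh, h0]
    rw [hcover, iUnion_eq_univ_iff.2 fun x => ⟨x, mem_ball_self hrpos⟩, measure_univ] at this
    exact one_ne_zero this
  have hhtop : h ≠ ∞ := measure_ne_top _ _
  have hs : MeasurableSet ({p : X × X | dist p.1 p.2 < r} ∩ univ ×ˢ U) :=
    (isOpen_lt continuous_dist continuous_const).measurableSet.inter
      (MeasurableSet.univ.prod hU.measurableSet)
  have key : h * μ (V j) ≤ h * ν U := calc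
    h * μ (V j) = ∫⁻ _ in V j, h ∂μ := by rw [setLIntegral_const]
    _ ≤ ∫⁻ x in V j, ν (Prod.mk x ⁻¹' ({p : X × X | dist p.1 p.2 < r} ∩ univ ×ˢ U)) ∂μ := by
      refine setLIntegral_mono (measurable_measure_prodMk_left hs) fun x hx => ?_
      rw [hh, hν o x]
      exact measure_mono fun z hz => ⟨by simpa [dist_comm] using hz, mem_univ _, hx hz⟩
    _ ≤ ∫⁻ x, ν (Prod.mk x ⁻¹' ({p : X × X | dist p.1 p.2 < r} ∩ univ ×ˢ U)) ∂μ :=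
      setLIntegral_le_lintegral _ _
    _ = ∫⁻ y, μ ((fun z => (z, y)) ⁻¹' ({p : X × X | dist p.1 p.2 < r} ∩ univ ×ˢ U)) ∂ν := by
      rw [← Measure.prod_apply hs, Measure.prod_apply_symm hs]
    _ ≤ ∫⁻ y, U.indicator (fun _ => h) y ∂ν := by
      refine lintegral_mono fun y => ?_
      by_cases hy : y ∈ U
      · rw [indicator_of_mem hy, hh, hν o y, ← measure_ball_eq_of_forall_measure_ball_eq hμ hν]
        exact measure_mono fun z hz => hz.1
      · rw [indicator_of_notMem hy]
        refine (measure_mono_null (fun z hz => hy hz.2.2) measure_empty).le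
    _ = h * ν U := by rw [lintegral_indicator_const hU.measurableSet]
  exact (ENNReal.mul_le_mul_iff_right hh0 hhtop).1 key

/-- Two probability measures on a separable metric space, each of which gives the same mass to all
balls of the same radius, coincide. -/
theorem measure_eq_of_forall_measure_ball_eq {X : Type*} [PseudoMetricSpace X]
    [SecondCountableTopology X] [MeasurableSpace X] [BorelSpace X] {μ ν : Measure X}
    [IsProbabilityMeasure μ] [IsProbabilityMeasure ν]
    (hμ : ∀ x y : X, ∀ r, μ (ball x r) = μ (ball y r))
    (hν : ∀ x y : X, ∀ r, ν (ball x r) = ν (ball y r)) : μ = ν :=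
  ext_of_generate_finite _ BorelSpace.measurable_eq isPiSystem_isOpen
    (fun _ hU => (measure_isOpen_le_of_forall_measure_ball_eq hμ hν hU).antisymm
      (measure_isOpen_le_of_forall_measure_ball_eq hν hμ hU)) (by simp)

section Sphere

open Module
open scoped Pointwise

variable {E : Type*} [NormedAddCommGroup E] [InnerProductSpace ℝ E]

theorem LinearIsometryEquiv.image_coe_ball_unitSphere (L : E ≃ₗᵢ[ℝ] E) {x y : sphere (0 : E) 1}
    (hL : L x = y) (r : ℝ) :
    L '' ((↑) '' ball x r) = ((↑) '' ball y r : Set E) := by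
  ext z
  simp only [mem_image, mem_ball, Subtype.exists, Subtype.dist_eq, mem_sphere_zero_iff_norm,
    exists_and_right, exists_eq_right]
  constructor
  · rintro ⟨w, ⟨hw, hd⟩, rfl⟩
    exact ⟨by rwa [L.norm_map], by rwa [← hL, L.dist_map]⟩
  · rintro ⟨hz, hd⟩
    refine ⟨L.symm z, ⟨by rwa [L.symm.norm_map], ?_⟩, by simp⟩
    rwa [← L.dist_map, hL, L.apply_symm_apply]

theorem exists_linearIsometryEquiv_unitSphere (x y : sphere (0 : E) 1) :
    ∃ L : E ≃ₗᵢ[ℝ] E, L x = y :=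
  ⟨(ℝ ∙ ((x : E) - y))ᗮ.reflection, Submodule.reflection_sub (by simp)⟩

theorem finrank_orthogonal_span_singleton_real [FiniteDimensional ℝ E] {v : E} (hv : v ≠ 0) :
    (finrank ℝ (ℝ ∙ v)ᗮ : ℝ) = (finrank ℝ E : ℝ) - 1 := by
  have h := Submodule.finrank_add_finrank_orthogonal (ℝ ∙ v)
  rw [finrank_span_singleton hv] at h
  rw [← h]
  push_cast
  ring

variable [MeasurableSpace E] [BorelSpace E]

theorem hausdorffMeasure_ball_unitSphere {d : ℝ} (hd : 0 ≤ d) (x y : sphere (0 : E) 1) (r : ℝ) :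
    μH[d] (ball x r) = μH[d] (ball y r) := by
  obtain ⟨L, hL⟩ := exists_linearIsometryEquiv_unitSphere x y
  rw [← isometry_subtype_coe.hausdorffMeasure_image (.inl hd) (ball x r),
    ← isometry_subtype_coe.hausdorffMeasure_image (.inl hd) (ball y r),
    ← L.image_coe_ball_unitSphere hL r, L.isometry.hausdorffMeasure_image (.inl hd)]

theorem restrict_hausdorffMeasure_sphere {d : ℝ} (hd : 0 ≤ d) {r : ℝ} (hr : 0 < r) :
    (μH[d] : Measure E).restrict (sphere 0 r) = (ENNReal.ofReal r ^ d) •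
      (μH[d] : Measure (sphere (0 : E) 1)).map fun ω : sphere (0 : E) 1 => r • (ω : E) := by
  ext s hs
  have hm : Measurable fun ω : sphere (0 : E) 1 => r • (ω : E) :=
    measurable_subtype_coe.const_smul r
  have himg : s ∩ sphere 0 r = r • ((↑) '' ((fun ω : sphere (0 : E) 1 => r • (ω : E)) ⁻¹' s)) := by
    ext z
    simp only [mem_inter_iff, mem_sphere_zero_iff_norm, mem_smul_set, mem_image, mem_preimage,
      Subtype.exists, exists_and_right, exists_eq_right]
    constructor
    · rintro ⟨hz, hzr⟩
      refine ⟨r⁻¹ • z, ⟨?_, ?_⟩, ?_⟩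
      · rw [norm_smul, hzr, norm_inv, Real.norm_of_nonneg hr.le, inv_mul_cancel₀ hr.ne']
      · rwa [smul_inv_smul₀ hr.ne']
      · rw [smul_inv_smul₀ hr.ne']
    · rintro ⟨w, ⟨hw, hws⟩, rfl⟩
      exact ⟨hws, by rw [norm_smul, hw, Real.norm_of_nonneg hr.le, mul_one]⟩
  rw [Measure.restrict_apply hs, Measure.smul_apply, Measure.map_apply hm hs, himg,
    Measure.hausdorffMeasure_smul₀ hd hr.ne',
    isometry_subtype_coe.hausdorffMeasure_image (.inl hd)]
  rw [ENNReal.smul_def, ENNReal.coe_rpow_of_nonneg _ hd, ← Real.enorm_of_nonneg hr.le]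
  rfl

variable [FiniteDimensional ℝ E]

theorem hausdorffMeasure_unitSphere_ne_top :
    μH[(finrank ℝ E : ℝ) - 1] (univ : Set (sphere (0 : E) 1)) ≠ ∞ := by
  refine (isCompact_univ.measure_lt_top_of_nhdsWithin fun x _ => ?_).ne
  have hx : ‖-(x : E)‖ = 1 := by simp
  have hv0 : -(x : E) ≠ 0 := by
    rw [← norm_ne_zero_iff, hx]; exact one_ne_zero
  have hdim := finrank_orthogonal_span_singleton_real hv0
  have hcd : ContDiff ℝ 1 fun w : (ℝ ∙ (-(x : E)))ᗮ => stereoInvFunAux (-(x : E)) w :=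
    contDiff_stereoInvFunAux.comp (ℝ ∙ (-(x : E)))ᗮ.subtypeL.contDiff
  obtain ⟨C, u, hu, hLip⟩ := (hcd.contDiffAt (x := 0)).exists_lipschitzOnWith
  have hLip' : LipschitzOnWith C (stereoInvFun hx) (u ∩ ball 0 1) :=
    fun a ha b hb => hLip ha.1 hb.1
  have hopen := isOpenEmbedding_stereographic_symm hx
  have h0 : (stereographic hx).symm 0 = x := by
    apply Subtype.ext
    change (stereoInvFun hx 0 : E) = x
    simp [stereoInvFun_apply]
  have hnhds : stereoInvFun hx '' (u ∩ ball 0 1) ∈ nhds x := by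
    have h := hopen.isOpenMap.image_mem_nhds (Filter.inter_mem hu (ball_mem_nhds _ one_pos))
    rwa [h0] at h
  refine ⟨_, mem_nhdsWithin_of_mem_nhds hnhds, ?_⟩
  rw [← hdim]
  refine (hLip'.hausdorffMeasure_image_le (Nat.cast_nonneg _)).trans_lt
    (ENNReal.mul_lt_top (ENNReal.rpow_lt_top_of_nonneg (Nat.cast_nonneg _) ENNReal.coe_ne_top) ?_)
  exact (measure_mono inter_subset_right).trans_lt measure_ball_lt_top

theorem hausdorffMeasure_unitSphere_ne_zero [Nontrivial E] :
    μH[(finrank ℝ E : ℝ) - 1] (univ : Set (sphere (0 : E) 1)) ≠ 0 := by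
  obtain ⟨v, hv⟩ := exists_norm_eq E zero_le_one
  have hv0 : v ≠ 0 := by
    rw [← norm_ne_zero_iff, hv]; exact one_ne_zero
  rw [← finrank_orthogonal_span_singleton_real hv0]
  have hLip : LipschitzWith 1 fun x : sphere (0 : E) 1 => (ℝ ∙ v)ᗮ.orthogonalProjectionOnto x := by
    refine LipschitzWith.of_dist_le_mul fun x y => ?_
    rw [NNReal.coe_one, one_mul, dist_eq_norm, ← map_sub, Subtype.dist_eq, dist_eq_norm]
    exact Submodule.norm_orthogonalProjectionOnto_apply_le _ _
  have hle := hLip.hausdorffMeasure_image_le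
    (d := (finrank ℝ (ℝ ∙ v)ᗮ : ℝ)) (Nat.cast_nonneg _) univ
  have hsub : ball (0 : (ℝ ∙ v)ᗮ) 1 ⊆
      (fun x : sphere (0 : E) 1 => (ℝ ∙ v)ᗮ.orthogonalProjectionOnto x) '' univ := by
    intro w hw
    have hw1 : ‖w‖ ^ 2 ≤ 1 := by
      have : ‖w‖ < 1 := by simpa using hw
      nlinarith [norm_nonneg w]
    have hvw : inner ℝ (w : E) v = 0 :=
      Submodule.mem_orthogonal_singleton_iff_inner_left.1 w.2
    refine ⟨⟨(w : E) + √(1 - ‖w‖ ^ 2) • v, ?_⟩, mem_univ _, ?_⟩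
    · rw [mem_sphere_zero_iff_norm, ← sq_eq_sq₀ (norm_nonneg _) zero_le_one, norm_add_sq_real,
        inner_smul_right, hvw, norm_smul, hv, mul_one, Real.norm_eq_abs, sq_abs,
        Real.sq_sqrt (by linarith)]
      simp
    · have hmem : v ∈ (ℝ ∙ v)ᗮᗮ :=
        Submodule.le_orthogonal_orthogonal _ (Submodule.mem_span_singleton_self v)
      simp [Submodule.orthogonalProjectionOnto_apply_of_mem_orthogonal hmem]
  intro h0
  rw [h0, mul_zero] at hle
  exact (measure_ball_pos (μH[(finrank ℝ (ℝ ∙ v)ᗮ : ℝ)]) (0 : (ℝ ∙ v)ᗮ) one_pos).ne'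
    (le_antisymm ((measure_mono hsub).trans hle) zero_le)

theorem toSphere_ball (x y : sphere (0 : E) 1) (r : ℝ) :
    (volume : Measure E).toSphere (ball x r) = (volume : Measure E).toSphere (ball y r) := by
  obtain ⟨L, hL⟩ := exists_linearIsometryEquiv_unitSphere x y
  rw [Measure.toSphere_apply' _ measurableSet_ball, Measure.toSphere_apply' _ measurableSet_ball,
    ← L.image_coe_ball_unitSphere hL r]
  have : Ioo (0 : ℝ) 1 • (L '' ((↑) '' ball x r)) = L '' (Ioo (0 : ℝ) 1 • ((↑) '' ball x r)) := by
    simp only [← image2_smul, image_image2, image2_image_right, map_smul]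
  rw [this]
  congr 1
  have hpre := (L.measurePreserving).measure_preimage_emb L.toHomeomorph.measurableEmbedding
    (L '' (Ioo (0 : ℝ) 1 • ((↑) '' ball x r)))
  rwa [preimage_image_eq _ L.injective] at hpre

/-- The normalized Hausdorff measure and the normalized cone measure on the unit sphere agree. -/
theorem normalized_hausdorffMeasure_unitSphere [Nontrivial E] :
    (μH[(finrank ℝ E : ℝ) - 1] (univ : Set (sphere (0 : E) 1)))⁻¹ •
        (μH[(finrank ℝ E : ℝ) - 1] : Measure (sphere (0 : E) 1)) =
      ((volume : Measure E).toSphere univ)⁻¹ • (volume : Measure E).toSphere := by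
  have hd : 0 ≤ (finrank ℝ E : ℝ) - 1 := by
    have : 1 ≤ finrank ℝ E := finrank_pos
    simpa using this
  have h₁ : IsProbabilityMeasure ((μH[(finrank ℝ E : ℝ) - 1] (univ : Set (sphere (0 : E) 1)))⁻¹ •
      (μH[(finrank ℝ E : ℝ) - 1] : Measure (sphere (0 : E) 1))) :=
    ⟨by
      rw [Measure.smul_apply, smul_eq_mul]
      exact ENNReal.inv_mul_cancel hausdorffMeasure_unitSphere_ne_zero
        hausdorffMeasure_unitSphere_ne_top⟩
  have h₂ : IsProbabilityMeasure
      (((volume : Measure E).toSphere univ)⁻¹ • (volume : Measure E).toSphere) :=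
    ⟨by
      rw [Measure.smul_apply, smul_eq_mul]
      exact ENNReal.inv_mul_cancel
        (Measure.measure_univ_ne_zero.2 (Measure.toSphere_ne_zero volume)) (measure_ne_top _ _)⟩
  refine measure_eq_of_forall_measure_ball_eq (fun x y r => ?_) fun x y r => ?_
  · simp only [Measure.smul_apply, hausdorffMeasure_ball_unitSphere hd x y]
  · simp only [Measure.smul_apply, toSphere_ball x y]

theorem lintegral_sphere_hausdorffMeasure_div [Nontrivial E] {f : E → ℝ≥0∞} (hf : Measurable f)
    {r : ℝ} (hr : 0 < r) :
    (∫⁻ x in sphere (0 : E) r, f x ∂(μH[(finrank ℝ E : ℝ) - 1])) /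
        μH[(finrank ℝ E : ℝ) - 1] (sphere (0 : E) r) =
      ∫⁻ ω : sphere (0 : E) 1, f (r • (ω : E))
        ∂(((volume : Measure E).toSphere univ)⁻¹ • (volume : Measure E).toSphere) := by
  have hd : 0 ≤ (finrank ℝ E : ℝ) - 1 := by
    have : 1 ≤ finrank ℝ E := finrank_pos
    simpa using this
  have hm : Measurable fun ω : sphere (0 : E) 1 => r • (ω : E) :=
    measurable_subtype_coe.const_smul r
  have hc0 : ENNReal.ofReal r ^ ((finrank ℝ E : ℝ) - 1) ≠ 0 :=
    (ENNReal.rpow_pos (ENNReal.ofReal_pos.2 hr) ENNReal.ofReal_ne_top).ne'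
  have hctop : ENNReal.ofReal r ^ ((finrank ℝ E : ℝ) - 1) ≠ ∞ :=
    ENNReal.rpow_ne_top_of_nonneg hd ENNReal.ofReal_ne_top
  rw [← normalized_hausdorffMeasure_unitSphere, lintegral_smul_measure,
    ← Measure.restrict_apply_univ (sphere (0 : E) r), restrict_hausdorffMeasure_sphere hd hr,
    lintegral_smul_measure, Measure.smul_apply, Measure.map_apply hm .univ, preimage_univ,
    lintegral_map hf hm, smul_eq_mul, smul_eq_mul, smul_eq_mul,
    ENNReal.mul_div_mul_left _ _ hc0 hctop, ENNReal.div_eq_inv_mul]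

/-- Integration over the unit ball in polar coordinates. -/
theorem lintegral_unitBall_eq_lintegral_toSphere [Nontrivial E] {f : E → ℝ≥0∞}
    (hf : Measurable f) :
    ∫⁻ x in ball (0 : E) 1, f x = ∫⁻ r in Ioo (0 : ℝ) 1, ENNReal.ofReal (r ^ (finrank ℝ E - 1)) *
      ∫⁻ ω : sphere (0 : E) 1, f (r • (ω : E)) ∂(volume : Measure E).toSphere := by
  set g : E → ℝ≥0∞ := (ball (0 : E) 1).indicator f with hg
  have hgm : Measurable g := hf.indicator measurableSet_ball
  have hprod : Measurable fun q : sphere (0 : E) 1 × Ioi (0 : ℝ) => g (q.2.1 • (q.1 : E)) :=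
    hgm.comp (by fun_prop)
  calc
    ∫⁻ x in ball (0 : E) 1, f x = ∫⁻ x, g x := (lintegral_indicator measurableSet_ball _).symm
    _ = ∫⁻ x : ({0}ᶜ : Set E), g x ∂((volume : Measure E).comap Subtype.val) := by
      rw [lintegral_subtype_comap (measurableSet_singleton _).compl, restrict_compl_singleton]
    _ = ∫⁻ q, g (q.2.1 • (q.1 : E))
          ∂(volume : Measure E).toSphere.prod (.volumeIoiPow (finrank ℝ E - 1)) := by
      rw [← (volume : Measure E).measurePreserving_homeomorphUnitSphereProd.lintegral_comp hprod]
      refine lintegral_congr fun x => ?_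
      congr 1
      exact (congrArg Subtype.val ((homeomorphUnitSphereProd E).symm_apply_apply x)).symm
    _ = ∫⁻ r : Ioi (0 : ℝ), ∫⁻ ω : sphere (0 : E) 1, g (r.1 • (ω : E))
          ∂(volume : Measure E).toSphere ∂(.volumeIoiPow (finrank ℝ E - 1)) :=
      lintegral_prod_symm' _ hprod
    _ = ∫⁻ r in Ioi (0 : ℝ), ENNReal.ofReal (r ^ (finrank ℝ E - 1)) *
          ∫⁻ ω : sphere (0 : E) 1, g (r • (ω : E)) ∂(volume : Measure E).toSphere := by
      rw [Measure.volumeIoiPow, lintegral_withDensity_eq_lintegral_mul _ (by fun_prop)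
        hprod.lintegral_prod_left']
      exact lintegral_subtype_comap measurableSet_Ioi fun r : ℝ =>
        ENNReal.ofReal (r ^ (finrank ℝ E - 1)) *
          ∫⁻ ω : sphere (0 : E) 1, g (r • (ω : E)) ∂(volume : Measure E).toSphere
    _ = _ := by
      rw [← Ioi_inter_Iio, inter_comm, ← setLIntegral_indicator measurableSet_Iio]
      refine setLIntegral_congr_fun measurableSet_Ioi fun r (hr : 0 < r) => ?_
      have hmem : ∀ ω : sphere (0 : E) 1, r • (ω : E) ∈ ball (0 : E) 1 ↔ r ∈ Iio (1 : ℝ) :=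
        fun ω => by simp [norm_smul, abs_of_pos hr]
      by_cases h : r ∈ Iio (1 : ℝ)
      · simp only [hg, indicator_of_mem ((hmem _).2 h), indicator_of_mem h]
      · simp only [hg, indicator_of_notMem (mt (hmem _).1 h), indicator_of_notMem h,
          lintegral_zero, mul_zero]

end Sphere

section Convex

variable {Φ : ℝ≥0∞ → ℝ≥0∞}

theorem convex_three_point
    (hconv : ∀ (a : ℝ≥0), a ≤ 1 → ∀ t₁ t₂ : ℝ≥0∞,
      Φ (a • t₁ + (1 - a) • t₂) ≤ a • Φ t₁ + (1 - a) • Φ t₂)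
    {x t y : ℝ≥0} (hxt : x < t) (hty : t < y) (hx : Φ x ≠ ∞) (hy : Φ y ≠ ∞) :
    ((y : ℝ) - x) * (Φ t).toReal ≤ (y - t) * (Φ x).toReal + (t - x) * (Φ y).toReal := by
  have hxt' : (x : ℝ) < t := hxt
  have hty' : (t : ℝ) < y := hty
  have hyx : 0 < (y : ℝ) - x := by linarith
  obtain ⟨a, ha⟩ : ∃ a : ℝ≥0, (a : ℝ) = (y - t) / (y - x) :=
    ⟨⟨(y - t) / (y - x), div_nonneg (by linarith) hyx.le⟩, rfl⟩
  have ha1 : a ≤ 1 := by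
    rw [← NNReal.coe_le_coe, ha, NNReal.coe_one, div_le_one hyx]
    linarith
  have hb : ((1 - a : ℝ≥0) : ℝ) = (t - x) / (y - x) := by
    rw [NNReal.coe_sub ha1, ha, NNReal.coe_one]
    field_simp
    ring
  have hcomb : a • (x : ℝ≥0∞) + (1 - a) • (y : ℝ≥0∞) = t := by
    have : a * x + (1 - a) * y = t := by
      rw [← NNReal.coe_inj, NNReal.coe_add, NNReal.coe_mul, NNReal.coe_mul, ha, hb]
      field_simp
      ring
    rw [← this]
    simp [ENNReal.smul_def]
  have h := hconv a ha1 x y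
  rw [hcomb] at h
  lift Φ x to ℝ≥0 using hx with u
  lift Φ y to ℝ≥0 using hy with w
  have h' : (Φ t).toReal ≤ a * u + (1 - a : ℝ≥0) * w := by
    refine ENNReal.toReal_le_of_le_ofReal (by positivity) (h.trans_eq ?_)
    rw [ENNReal.smul_def, ENNReal.smul_def, smul_eq_mul, smul_eq_mul]
    norm_cast
    rw [ENNReal.ofReal_coe_nnreal]
  rw [ha, hb] at h'
  calc ((y : ℝ) - x) * (Φ t).toReal
      ≤ (y - x) * ((y - t) / (y - x) * u + (t - x) / (y - x) * w) := by gcongr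
    _ = _ := by
      simp only [ENNReal.coe_toReal]
      field_simp

/-- A non-decreasing convex function on `[0,∞]` has a supporting affine function at every point to
the left of a point where it is finite. -/
theorem exists_affine_minorant (hmono : Monotone Φ)
    (hconv : ∀ (a : ℝ≥0), a ≤ 1 → ∀ t₁ t₂ : ℝ≥0∞,
      Φ (a • t₁ + (1 - a) • t₂) ≤ a • Φ t₁ + (1 - a) • Φ t₂)
    {t s : ℝ≥0∞} (hts : t < s) (hs : Φ s ≠ ∞) :
    ∃ m : ℝ≥0, ∀ x, m * x + Φ t ≤ Φ x + m * t := by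
  obtain ⟨s', hts', hs's⟩ := exists_between hts
  have hΦs' : Φ s' ≠ ∞ := ne_top_of_le_ne_top hs (hmono hs's.le)
  have hΦt : Φ t ≠ ∞ := ne_top_of_le_ne_top hs (hmono hts.le)
  lift s' to ℝ≥0 using hs's.ne_top
  lift t to ℝ≥0 using hts.ne_top
  have hts'' : t < s' := by exact_mod_cast hts'
  let q : ℝ≥0 → ℝ := fun y => ((Φ y).toReal - (Φ t).toReal) / (y - t)
  let D : Set ℝ≥0 := {y | t < y ∧ Φ y ≠ ∞}
  have hDne : D.Nonempty := ⟨s', hts'', hΦs'⟩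
  have hq0 : ∀ y ∈ D, 0 ≤ q y := fun y hy => div_nonneg
    (sub_nonneg.2 (ENNReal.toReal_mono hy.2 (hmono (by exact_mod_cast hy.1.le))))
    (sub_nonneg.2 (by exact_mod_cast hy.1.le))
  have hbdd : BddBelow (q '' D) := ⟨0, forall_mem_image.2 hq0⟩
  have hm0 : 0 ≤ sInf (q '' D) := le_csInf (hDne.image q) (forall_mem_image.2 hq0)
  obtain ⟨m, hm⟩ : ∃ m : ℝ≥0, (m : ℝ) = sInf (q '' D) := ⟨⟨_, hm0⟩, rfl⟩
  refine ⟨m, fun x => ?_⟩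
  by_cases hΦx : Φ x = ∞
  · simp [hΦx]
  by_cases hx : x = ∞
  · subst hx
    have hle : Φ ∞ ≤ Φ t := by
      have h := hconv 2⁻¹ (by norm_num) t ∞
      have h2 : (1 - 2⁻¹ : ℝ≥0) = 2⁻¹ := by
        rw [← NNReal.coe_inj, NNReal.coe_sub (by norm_num)]
        norm_num
      rw [h2, show (2⁻¹ : ℝ≥0) • (∞ : ℝ≥0∞) = ∞ by simp [ENNReal.smul_def], add_top] at h
      lift Φ ∞ to ℝ≥0 using hΦx with u
      lift Φ t to ℝ≥0 using hΦt with w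
      rw [ENNReal.smul_def, ENNReal.smul_def, smul_eq_mul, smul_eq_mul] at h
      norm_cast at h ⊢
      rw [← NNReal.coe_le_coe] at h ⊢
      push_cast at h
      linarith
    have hm' : m = 0 := by
      rw [← NNReal.coe_eq_zero]
      refine le_antisymm (hm.trans_le ((csInf_le hbdd ⟨s', ⟨hts'', hΦs'⟩, rfl⟩).trans ?_)) m.2
      refine div_nonpos_of_nonpos_of_nonneg
        (sub_nonpos.2 (ENNReal.toReal_mono hΦt ((hmono le_top).trans hle)))
        (sub_nonneg.2 (by exact_mod_cast hts''.le))
    simpa [hm'] using hmono le_top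
  lift x to ℝ≥0 using hx
  suffices h : (m : ℝ) * x + (Φ t).toReal ≤ (Φ x).toReal + m * t by
    rw [← ENNReal.toReal_le_toReal (by finiteness) (by finiteness),
      ENNReal.toReal_add (by finiteness) (by finiteness),
      ENNReal.toReal_add (by finiteness) (by finiteness)]
    simpa using h
  rcases lt_trichotomy x t with hxt | rfl | hxt
  · have hxt' : (0 : ℝ) < t - x := sub_pos.2 (by exact_mod_cast hxt)
    have hl : ((Φ t).toReal - (Φ x).toReal) / (t - x) ≤ m := by
      rw [hm]
      refine le_csInf (hDne.image q) (forall_mem_image.2 fun y hy => ?_)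
      have hty : (0 : ℝ) < y - t := sub_pos.2 (by exact_mod_cast hy.1)
      rw [div_le_div_iff₀ hxt' hty]
      linarith [convex_three_point hconv hxt hy.1 hΦx hy.2]
    rw [div_le_iff₀ hxt'] at hl
    linarith
  · linarith
  · have hxt' : (0 : ℝ) < x - t := sub_pos.2 (by exact_mod_cast hxt)
    have hl : (m : ℝ) ≤ ((Φ x).toReal - (Φ t).toReal) / (x - t) :=
      hm.trans_le (csInf_le hbdd ⟨x, ⟨hxt, hΦx⟩, rfl⟩)
    rw [le_div_iff₀ hxt'] at hl
    linarith

/-- A form of Jensen's inequality: if the mean of `Φ ∘ f` is less than `τ`, then the mean of `f`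
is at most `Φ⁻¹(τ)`. -/
theorem lintegral_le_genInv {α : Type*} [MeasurableSpace α] {μ : Measure α}
    [IsProbabilityMeasure μ] (hmono : Monotone Φ)
    (hconv : ∀ (a : ℝ≥0), a ≤ 1 → ∀ t₁ t₂ : ℝ≥0∞,
      Φ (a • t₁ + (1 - a) • t₂) ≤ a • Φ t₁ + (1 - a) • Φ t₂)
    {f : α → ℝ≥0∞} (hf : Measurable f) {τ : ℝ≥0∞} (hτ : ∫⁻ x, Φ (f x) ∂μ < τ) :
    ∫⁻ x, f x ∂μ ≤ genInv Φ τ := by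
  have hΦf : Measurable fun x => Φ (f x) := hmono.measurable.comp hf
  refine le_sInf fun t (ht : τ ≤ Φ t) => ?_
  by_cases h : ∃ s, t < s ∧ Φ s ≠ ∞
  · obtain ⟨s, hts, hs⟩ := h
    have hΦt : Φ t ≠ ∞ := ne_top_of_le_ne_top hs (hmono hts.le)
    obtain ⟨m, hm⟩ := exists_affine_minorant hmono hconv hts hs
    have hint : m * ∫⁻ x, f x ∂μ + Φ t ≤ ∫⁻ x, Φ (f x) ∂μ + m * t := by
      have h := lintegral_mono (μ := μ) fun x => hm (f x)
      rwa [lintegral_add_right _ measurable_const, lintegral_add_right _ measurable_const,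
        lintegral_const_mul _ hf, lintegral_const, lintegral_const, measure_univ, mul_one,
        mul_one] at h
    have hlt := hτ.trans_le ht
    have hm0 : m ≠ 0 := by
      rintro rfl
      simp only [ENNReal.coe_zero, zero_mul, zero_add, add_zero] at hint
      exact hint.not_gt hlt
    have hle : m * ∫⁻ x, f x ∂μ + Φ t ≤ m * t + Φ t := by
      rw [add_comm (m * t : ℝ≥0∞)]
      exact hint.trans (by gcongr)
    exact (ENNReal.mul_le_mul_iff_right (by simpa using hm0) ENNReal.coe_ne_top).1
      ((ENNReal.add_le_add_iff_right hΦt).1 hle)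
  · push Not at h
    have hae : ∀ᵐ x ∂μ, f x ≤ t := by
      filter_upwards [ae_lt_top hΦf hτ.ne_top] with x hx
      by_contra hlt
      exact hx.ne (h _ (not_le.1 hlt))
    simpa using lintegral_mono_ae hae

end Convex

section Radial

/-- Among the subsets of `(0,1)` whose complement has at most a given measure, an initial interval
minimizes the integral of a non-decreasing function. -/
theorem lintegral_le_lintegral_sdiff_of_monotoneOn {μ : Measure ℝ} {ψ : ℝ → ℝ≥0∞} {b : ℝ}
    (hb : b ∈ Ioo (0 : ℝ) 1) (hψ : MonotoneOn ψ (Ioo 0 1)) {T : Set ℝ} (hT : MeasurableSet T)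
    (hTμ : μ (Ioo 0 1 ∩ T) ≤ μ (Ico b 1)) (hfin : μ (Ico b 1) ≠ ∞) :
    ∫⁻ r in Ioo 0 b, ψ r ∂μ ≤ ∫⁻ r in Ioo 0 1 \ T, ψ r ∂μ := by
  have hsub : Ico b 1 ⊆ Ioo (0 : ℝ) 1 := fun r hr => ⟨hb.1.trans_le hr.1, hr.2⟩
  have hsplit : Ioo 0 b ∪ Ico b 1 = Ioo (0 : ℝ) 1 := Ioo_union_Ico_eq_Ioo hb.1 hb.2.le
  have hdisj : Disjoint (Ioo 0 b) (Ico b 1) :=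
    disjoint_left.2 fun r h₁ h₂ => h₁.2.not_ge h₂.1
  have hmass : μ (Ioo 0 b ∩ T) ≤ μ (Ico b 1 \ T) := by
    have h₁ : μ (Ioo 0 b ∩ T) + μ (Ico b 1 ∩ T) ≤ μ (Ico b 1 \ T) + μ (Ico b 1 ∩ T) := by
      rw [add_comm (μ (Ico b 1 \ T)), measure_inter_add_sdiff _ hT,
        ← measure_union (hdisj.mono inter_subset_left inter_subset_left)
          (measurableSet_Ico.inter hT), ← union_inter_distrib_right, hsplit]
      exact hTμ
    exact (ENNReal.add_le_add_iff_right
      (ne_top_of_le_ne_top hfin (measure_mono inter_subset_left))).1 h₁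
  calc ∫⁻ r in Ioo 0 b, ψ r ∂μ
      = ∫⁻ r in Ioo 0 b \ T, ψ r ∂μ + ∫⁻ r in Ioo 0 b ∩ T, ψ r ∂μ := by
        rw [add_comm, lintegral_inter_add_sdiff _ _ hT]
    _ ≤ ∫⁻ r in Ioo 0 b \ T, ψ r ∂μ + ∫⁻ r in Ico b 1 \ T, ψ r ∂μ := by
        refine add_le_add_right ?_ _
        calc ∫⁻ r in Ioo 0 b ∩ T, ψ r ∂μ ≤ ∫⁻ _ in Ioo 0 b ∩ T, ψ b ∂μ :=
              setLIntegral_mono measurable_const fun r hr =>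
                hψ ⟨hr.1.1, hr.1.2.trans hb.2⟩ hb hr.1.2.le
          _ ≤ ∫⁻ _ in Ico b 1 \ T, ψ b ∂μ := by
              rw [setLIntegral_const, setLIntegral_const]
              gcongr
          _ ≤ ∫⁻ r in Ico b 1 \ T, ψ r ∂μ :=
              setLIntegral_mono' (measurableSet_Ico.diff hT) fun r hr => hψ hb (hsub hr.1) hr.1.1
    _ = ∫⁻ r in Ioo 0 1 \ T, ψ r ∂μ := by
        rw [← lintegral_union (measurableSet_Ico.diff hT) (hdisj.mono sdiff_subset sdiff_subset),
          ← union_sdiff_distrib, hsplit]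

/-- The measure `dr/r` on the positive half-line. -/
noncomputable def logMeasure : Measure ℝ := volume.withDensity fun r => (ENNReal.ofReal r)⁻¹

theorem setLIntegral_logMeasure (f : ℝ → ℝ≥0∞) {s : Set ℝ} (hs : MeasurableSet s)
    (hpos : ∀ r ∈ s, 0 < r) :
    ∫⁻ r in s, f r ∂logMeasure = ∫⁻ r in s, (ENNReal.ofReal r)⁻¹ * f r := by
  rw [logMeasure, restrict_withDensity hs,
    lintegral_withDensity_eq_lintegral_mul_non_measurable₀ _ (by fun_prop)]
  · rfl
  · filter_upwards [ae_restrict_mem hs] with r hr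
    simpa using hpos r hr

theorem logMeasure_Ico {a b : ℝ} (ha : 0 < a) (hab : a ≤ b) :
    logMeasure (Ico a b) = ENNReal.ofReal (Real.log (b / a)) := by
  rw [logMeasure, withDensity_apply _ measurableSet_Ico, Measure.restrict_congr_set Ico_ae_eq_Ioc,
    ← integral_inv_of_pos ha (ha.trans_le hab), intervalIntegral.integral_of_le hab,
    ofReal_integral_eq_lintegral_ofReal]
  · refine setLIntegral_congr_fun measurableSet_Ioc fun r hr => ?_
    rw [ENNReal.ofReal_inv_of_pos (ha.trans hr.1)]
  · refine (ContinuousOn.integrableOn_Icc ?_).mono_set Ioc_subset_Icc_self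
    exact continuousOn_id.inv₀ fun r hr => (ha.trans_le hr.1).ne'
  · filter_upwards [ae_restrict_mem measurableSet_Ioc] with r hr
    exact inv_nonneg.2 (ha.trans hr.1).le

/-- The substitution `τ = m / rⁿ`. -/
theorem setLIntegral_Ioi_div_pow {n : ℕ} (hn : n ≠ 0) {m b : ℝ} (hm : 0 < m) (hb : 0 < b)
    (f : ℝ → ℝ≥0∞) :
    ∫⁻ τ in Ioi (m / b ^ n), (ENNReal.ofReal τ)⁻¹ * f τ =
      n * ∫⁻ r in Ioo 0 b, (ENNReal.ofReal r)⁻¹ * f (m / r ^ n) := by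
  have himg : (fun r : ℝ => m / r ^ n) '' Ioo 0 b = Ioi (m / b ^ n) := by
    ext τ
    constructor
    · rintro ⟨r, hr, rfl⟩
      exact div_lt_div_of_pos_left hm (pow_pos hr.1 n) (pow_lt_pow_left₀ hr.2 hr.1.le hn)
    · intro hτ
      have hτ0 : 0 < τ := lt_trans (by positivity) hτ
      have hpow : ((m / τ) ^ ((n : ℝ)⁻¹)) ^ n = m / τ :=
        Real.rpow_inv_natCast_pow (by positivity) hn
      refine ⟨(m / τ) ^ ((n : ℝ)⁻¹), ⟨by positivity, ?_⟩, ?_⟩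
      · refine lt_of_pow_lt_pow_left₀ n hb.le ?_
        rw [hpow, div_lt_comm₀ hτ0 (by positivity)]
        exact hτ
      · simp only [hpow]
        field_simp
  have hinj : InjOn (fun r : ℝ => m / r ^ n) (Ioo 0 b) := by
    intro r hr s hs h
    have hr' := pow_pos hr.1 n
    have hs' := pow_pos hs.1 n
    simp only at h
    rw [div_eq_div_iff hr'.ne' hs'.ne'] at h
    exact (pow_left_inj₀ hr.1.le hs.1.le hn).1 (mul_left_cancel₀ hm.ne' h).symm
  have hderiv : ∀ r ∈ Ioo 0 b, HasDerivWithinAt (fun r : ℝ => m / r ^ n)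
      (-(n * m / r ^ (n + 1))) (Ioo 0 b) r := by
    intro r hr
    have hr0 := hr.1.ne'
    have h := ((hasDerivAt_pow n r).inv (pow_ne_zero n hr0)).const_mul m
    refine HasDerivAt.hasDerivWithinAt (h.congr_deriv ?_)
    obtain ⟨k, rfl⟩ := Nat.exists_eq_succ_of_ne_zero hn
    simp only [Nat.succ_eq_add_one, Nat.add_sub_cancel]
    field_simp
    ring
  rw [← himg, lintegral_image_eq_lintegral_abs_deriv_mul measurableSet_Ioo hderiv hinj,
    ← lintegral_const_mul' _ _ (ENNReal.natCast_ne_top n)]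
  refine setLIntegral_congr_fun measurableSet_Ioo fun r hr => ?_
  have hr0 : 0 < r := hr.1
  rw [abs_neg, abs_of_pos (by positivity), ← mul_assoc, ← mul_assoc,
    ← ENNReal.ofReal_inv_of_pos (by positivity), ← ENNReal.ofReal_inv_of_pos hr0,
    ← ENNReal.ofReal_mul (by positivity), ← ENNReal.ofReal_natCast,
    ← ENNReal.ofReal_mul (by positivity)]
  congr 2
  field_simp
  ring

theorem inv_mul_lintegral_le_of_lintegral_le {n : ℕ} (hn : n ≠ 0) {A k g : ℝ → ℝ≥0∞} {p : ℝ}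
    (hp : 0 < p) (hA : Measurable A) (hg : Monotone g) {m : ℝ} (hm : 0 < m)
    (hAm : ∫⁻ r in Ioo (0 : ℝ) 1, n * ENNReal.ofReal (r ^ (n - 1)) * A r ≤ ENNReal.ofReal m)
    (hk : ∀ r ∈ Ioo (0 : ℝ) 1, ∀ τ : ℝ, A r < ENNReal.ofReal τ → k r ≤ g τ) :
    (n : ℝ≥0∞)⁻¹ * ∫⁻ τ in Ioi (Real.exp 1 * m), (ENNReal.ofReal τ * g τ ^ (1 / p))⁻¹ ≤
      ∫⁻ r in Ioo (0 : ℝ) 1, (ENNReal.ofReal r * k r ^ (1 / p))⁻¹ := by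
  have hn' : (0 : ℝ) < n := by positivity
  have hp' : 0 ≤ 1 / p := by positivity
  have hinv : ∀ {r : ℝ} (_ : 0 < r) (c : ℝ≥0∞),
      (ENNReal.ofReal r * c)⁻¹ = (ENNReal.ofReal r)⁻¹ * c⁻¹ := fun hr c =>
    ENNReal.mul_inv (.inl (by simpa using hr)) (.inl ENNReal.ofReal_ne_top)
  set b : ℝ := Real.exp (-(n : ℝ)⁻¹) with hb
  have hb0 : 0 < b := Real.exp_pos _
  have hb1 : b < 1 := Real.exp_lt_one_iff.2 (by simpa using hn')
  have hbn : m / b ^ n = Real.exp 1 * m := by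
    rw [hb, ← Real.exp_nat_mul, mul_neg, mul_inv_cancel₀ hn'.ne', Real.exp_neg, div_inv_eq_mul,
      mul_comm]
  set ψ : ℝ → ℝ≥0∞ := fun r => (g (m / r ^ n) ^ (1 / p))⁻¹ with hψ
  have hψmono : MonotoneOn ψ (Ioo 0 1) := by
    intro r hr s hs hrs
    refine ENNReal.inv_le_inv.2 (ENNReal.rpow_le_rpow (hg ?_) hp')
    have := hr.1
    gcongr
  set T : Set ℝ := {r | ENNReal.ofReal m ≤ ENNReal.ofReal (r ^ n) * A r} with hT
  have hTm : MeasurableSet T := measurableSet_le measurable_const (by fun_prop)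
  have hIco : logMeasure (Ico b 1) = (n : ℝ≥0∞)⁻¹ := by
    rw [logMeasure_Ico hb0 hb1.le, one_div, Real.log_inv, hb, Real.log_exp, neg_neg,
      ENNReal.ofReal_inv_of_pos hn', ENNReal.ofReal_natCast]
  have hTμ : logMeasure (Ioo 0 1 ∩ T) ≤ logMeasure (Ico b 1) := by
    rw [hIco, ENNReal.le_inv_iff_mul_le]
    have hm0 : ENNReal.ofReal m ≠ 0 := by simpa using hm
    rw [← ENNReal.mul_le_mul_iff_right hm0 ENNReal.ofReal_ne_top, mul_one]
    refine le_trans ?_ hAm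
    have hms : MeasurableSet (Ioo 0 1 ∩ T) := measurableSet_Ioo.inter hTm
    rw [← setLIntegral_one, setLIntegral_logMeasure _ hms fun r hr => hr.1.1,
      mul_comm (ENNReal.ofReal m), mul_assoc, ← lintegral_mul_const _ (by fun_prop)]
    refine le_trans ?_ (lintegral_mono_set (inter_subset_left (t := T)))
    refine setLIntegral_mono (by fun_prop) fun r hr => ?_
    have hr0 := hr.1.1
    have hpow : ENNReal.ofReal (r ^ (n - 1)) = (ENNReal.ofReal r)⁻¹ * ENNReal.ofReal (r ^ n) := by
      rw [← ENNReal.ofReal_inv_of_pos hr0, ← ENNReal.ofReal_mul (by positivity)]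
      congr 1
      obtain ⟨k, rfl⟩ := Nat.exists_eq_succ_of_ne_zero hn
      simp only [Nat.succ_eq_add_one, Nat.add_sub_cancel]
      field_simp
      ring
    rw [hpow, mul_one]
    calc (ENNReal.ofReal r)⁻¹ * (n * ENNReal.ofReal m)
        ≤ (ENNReal.ofReal r)⁻¹ * (n * (ENNReal.ofReal (r ^ n) * A r)) := by gcongr; exact hr.2
      _ = _ := by ring
  calc (n : ℝ≥0∞)⁻¹ * ∫⁻ τ in Ioi (Real.exp 1 * m), (ENNReal.ofReal τ * g τ ^ (1 / p))⁻¹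
      = (n : ℝ≥0∞)⁻¹ * ∫⁻ τ in Ioi (m / b ^ n), (ENNReal.ofReal τ)⁻¹ * (g τ ^ (1 / p))⁻¹ := by
        rw [hbn]
        congr 1
        exact setLIntegral_congr_fun measurableSet_Ioi fun τ hτ =>
          hinv (lt_trans (by positivity) hτ) _
    _ = ∫⁻ r in Ioo 0 b, (ENNReal.ofReal r)⁻¹ * ψ r := by
        rw [setLIntegral_Ioi_div_pow hn hm hb0 fun τ => (g τ ^ (1 / p))⁻¹, ← mul_assoc,
          ENNReal.inv_mul_cancel (by simpa using hn) (ENNReal.natCast_ne_top n), one_mul]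
    _ = ∫⁻ r in Ioo 0 b, ψ r ∂logMeasure :=
        (setLIntegral_logMeasure _ measurableSet_Ioo fun r hr => hr.1).symm
    _ ≤ ∫⁻ r in Ioo 0 1 \ T, ψ r ∂logMeasure :=
        lintegral_le_lintegral_sdiff_of_monotoneOn ⟨hb0, hb1⟩ hψmono hTm hTμ
          (by rw [hIco]; simpa using hn)
    _ = ∫⁻ r in Ioo 0 1 \ T, (ENNReal.ofReal r)⁻¹ * ψ r :=
        setLIntegral_logMeasure _ (measurableSet_Ioo.diff hTm) fun r hr => hr.1.1
    _ ≤ ∫⁻ r in Ioo 0 1 \ T, (ENNReal.ofReal r * k r ^ (1 / p))⁻¹ := by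
        refine setLIntegral_mono' (measurableSet_Ioo.diff hTm) fun r hr => ?_
        have hr0 := hr.1.1
        rw [hinv hr0]
        refine mul_le_mul_right (ENNReal.inv_le_inv.2 (ENNReal.rpow_le_rpow ?_ hp')) _
        refine hk r hr.1 _ ?_
        have hlt : ENNReal.ofReal (r ^ n) * A r < ENNReal.ofReal m := not_le.1 hr.2
        rw [ENNReal.ofReal_div_of_pos (by positivity), ENNReal.lt_div_iff_mul_lt
          (.inl (by simpa using pow_pos hr0 n)) (.inl ENNReal.ofReal_ne_top), mul_comm]
        exact hlt
    _ ≤ ∫⁻ r in Ioo (0 : ℝ) 1, (ENNReal.ofReal r * k r ^ (1 / p))⁻¹ :=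
        lintegral_mono_set sdiff_subset

end Radial

section Average

theorem genInv_mono (Φ : ℝ≥0∞ → ℝ≥0∞) : Monotone (genInv Φ) :=
  fun _ _ h => sInf_le_sInf fun _ ht => h.trans ht

theorem sphereAvg_eq_lintegral_toSphere {n : ℕ} [NeZero n]
    {K : EuclideanSpace ℝ (Fin n) → ℝ≥0∞} (hK : Measurable K) {r : ℝ} (hr : 0 < r) :
    sphereAvg n K r = ∫⁻ ω : sphere (0 : EuclideanSpace ℝ (Fin n)) 1, K (r • ω.1)
      ∂(((volume : Measure (EuclideanSpace ℝ (Fin n))).toSphere univ)⁻¹ • volume.toSphere) := by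
  have h := lintegral_sphere_hausdorffMeasure_div hK hr
  rwa [finrank_euclideanSpace_fin] at h

/-- The mean over the unit ball is the radial integral of the spherical means. -/
theorem lintegral_lintegral_toSphere_eq_average {n : ℕ} [NeZero n]
    {f : EuclideanSpace ℝ (Fin n) → ℝ≥0∞} (hf : Measurable f) :
    ∫⁻ r in Ioo (0 : ℝ) 1, n * ENNReal.ofReal (r ^ (n - 1)) *
        ∫⁻ ω : sphere (0 : EuclideanSpace ℝ (Fin n)) 1, f (r • ω.1)
          ∂(((volume : Measure (EuclideanSpace ℝ (Fin n))).toSphere univ)⁻¹ • volume.toSphere) =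
      (∫⁻ x in ball (0 : EuclideanSpace ℝ (Fin n)) 1, f x) /
        volume (ball (0 : EuclideanSpace ℝ (Fin n)) 1) := by
  have hn0 : (n : ℝ≥0∞) ≠ 0 := by simpa using NeZero.ne n
  have hv0 : volume (ball (0 : EuclideanSpace ℝ (Fin n)) 1) ≠ 0 :=
    (measure_ball_pos _ _ one_pos).ne'
  rw [lintegral_unitBall_eq_lintegral_toSphere hf, finrank_euclideanSpace_fin,
    ENNReal.div_eq_inv_mul, ← lintegral_const_mul' _ _ (ENNReal.inv_ne_top.2 hv0)]
  refine lintegral_congr fun r => ?_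
  rw [lintegral_smul_measure, smul_eq_mul, Measure.toSphere_apply_univ,
    finrank_euclideanSpace_fin, ENNReal.mul_inv (.inl hn0) (.inl (ENNReal.natCast_ne_top n))]
  generalize ∫⁻ ω : sphere (0 : EuclideanSpace ℝ (Fin n)) 1, f (r • ω.1) ∂volume.toSphere = I
  calc _ = ((n : ℝ≥0∞) * (n : ℝ≥0∞)⁻¹) * ((volume (ball (0 : EuclideanSpace ℝ (Fin n)) 1))⁻¹ *
        (ENNReal.ofReal (r ^ (n - 1)) * I)) := by ring
    _ = _ := by rw [ENNReal.mul_inv_cancel hn0 (ENNReal.natCast_ne_top n), one_mul]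

end Average

/-- Let `n ≥ 2`, `K : 𝔹ⁿ → [0,∞]` measurable, `Φ : [0,∞] → [0,∞]`
non-decreasing and convex, `p ∈ (0,∞)`.  Then
`∫₀¹ dr/(r k(r)^{1/p}) ≥ (1/n) ∫_{eM}^∞ dτ/(τ [Φ⁻¹(τ)]^{1/p})`, where `k(r)` is the
spherical average of `K` and `M` is the mean of `Φ∘K` over the unit ball. -/
theorem stmt_0 (n : ℕ) (hn : 2 ≤ n)
    (K : EuclideanSpace ℝ (Fin n) → ℝ≥0∞) (hK : Measurable K)
    (Φ : ℝ≥0∞ → ℝ≥0∞) (hΦmono : Monotone Φ)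
    (hΦconv : ∀ (a : ℝ≥0), a ≤ 1 → ∀ t₁ t₂ : ℝ≥0∞,
      Φ (a • t₁ + (1 - a) • t₂) ≤ a • Φ t₁ + (1 - a) • Φ t₂)
    (p : ℝ) (hp : 0 < p)
    (M : ℝ≥0∞)
    (hM : M = (∫⁻ x in Metric.ball (0 : EuclideanSpace ℝ (Fin n)) 1, Φ (K x)) /
      volume (Metric.ball (0 : EuclideanSpace ℝ (Fin n)) 1)) :
    (n : ℝ≥0∞)⁻¹ *
        ∫⁻ τ in {τ : ℝ | ENNReal.ofReal (Real.exp 1) * M < ENNReal.ofReal τ},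
          (ENNReal.ofReal τ * (genInv Φ (ENNReal.ofReal τ)) ^ (1 / p))⁻¹
      ≤ ∫⁻ r in Set.Ioo (0 : ℝ) 1,
          (ENNReal.ofReal r * (sphereAvg n K r) ^ (1 / p))⁻¹ := by
  have : NeZero n := ⟨by omega⟩
  have hΦK : Measurable fun x => Φ (K x) := hΦmono.measurable.comp hK
  set P : Measure (sphere (0 : EuclideanSpace ℝ (Fin n)) 1) :=
    ((volume : Measure (EuclideanSpace ℝ (Fin n))).toSphere univ)⁻¹ • volume.toSphere with hP
  have hPprob : IsProbabilityMeasure P := ⟨by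
    rw [hP, Measure.smul_apply, smul_eq_mul]
    exact ENNReal.inv_mul_cancel
      (Measure.measure_univ_ne_zero.2 (Measure.toSphere_ne_zero volume)) (measure_ne_top _ _)⟩
  set A : ℝ → ℝ≥0∞ := fun r => ∫⁻ ω, Φ (K (r • ω.1)) ∂P with hA
  have hAmeas : Measurable A := by
    have : Measurable fun q : ℝ × sphere (0 : EuclideanSpace ℝ (Fin n)) 1 =>
        Φ (K (q.1 • q.2.1)) := hΦK.comp (by fun_prop)
    exact this.lintegral_prod_right'
  have hAM : ∫⁻ r in Ioo (0 : ℝ) 1, n * ENNReal.ofReal (r ^ (n - 1)) * A r = M :=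
    (lintegral_lintegral_toSphere_eq_average hΦK).trans hM.symm
  have key : ∀ m : ℝ, 0 < m → M ≤ ENNReal.ofReal m → (n : ℝ≥0∞)⁻¹ *
      ∫⁻ τ in Ioi (Real.exp 1 * m),
        (ENNReal.ofReal τ * (genInv Φ (ENNReal.ofReal τ)) ^ (1 / p))⁻¹ ≤
      ∫⁻ r in Ioo (0 : ℝ) 1, (ENNReal.ofReal r * (sphereAvg n K r) ^ (1 / p))⁻¹ := by
    intro m hm hMm
    refine inv_mul_lintegral_le_of_lintegral_le (g := fun τ => genInv Φ (ENNReal.ofReal τ))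
      (NeZero.ne n) hp hAmeas ((genInv_mono Φ).comp ENNReal.ofReal_mono) hm (hAM.trans_le hMm)
      fun r hr τ hτ => ?_
    rw [sphereAvg_eq_lintegral_toSphere hK hr.1]
    exact lintegral_le_genInv hΦmono hΦconv (hK.comp (by fun_prop)) hτ
  rcases eq_or_ne M ∞ with hMtop | hMtop
  · simp [hMtop, ENNReal.mul_top, Real.exp_pos]
  have hset : {τ : ℝ | ENNReal.ofReal (Real.exp 1) * M < ENNReal.ofReal τ} =
      Ioi (Real.exp 1 * M.toReal) := by
    ext τ
    rw [mem_ofPred_eq, mem_Ioi, ← ENNReal.ofReal_lt_ofReal_iff_of_nonneg (by positivity),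
      ENNReal.ofReal_mul (by positivity), ENNReal.ofReal_toReal hMtop]
  rw [hset]
  rcases eq_or_ne M 0 with hM0 | hM0
  · have hunion : Ioi (Real.exp 1 * M.toReal) =
        ⋃ j : ℕ, Ioi (Real.exp 1 * (1 / ((j : ℝ) + 1))) := by
      ext τ
      simp only [hM0, ENNReal.toReal_zero, mul_zero, mem_Ioi, mem_iUnion]
      constructor
      · intro hτ
        obtain ⟨j, hj⟩ := exists_nat_one_div_lt (div_pos hτ (Real.exp_pos 1))
        exact ⟨j, by rwa [lt_div_iff₀' (Real.exp_pos 1)] at hj⟩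
      · rintro ⟨j, hj⟩
        exact lt_trans (by positivity) hj
    have hmono : Monotone fun j : ℕ => Ioi (Real.exp 1 * (1 / ((j : ℝ) + 1))) :=
      fun i j hij => Ioi_subset_Ioi (by gcongr)
    rw [hunion, setLIntegral_iUnion_of_directed _ hmono.directed_le, ENNReal.mul_iSup]
    exact iSup_le fun j => key _ (by positivity) (by simp [hM0])
  · exact key _ (ENNReal.toReal_pos hM0 hMtop) (ENNReal.ofReal_toReal hMtop).ge
end

section
/- Let n ≥ 2, let D be a bounded domain in ℝⁿ, let Q : D → (0,∞) be measurable, extended by 0 to ℝⁿ \ D, and let Φ : [0,∞] → [0,∞] be convex and non-decreasing. Assume ∫_D Φ(Q^{n−1}(x)) dm(x) < ∞ and ∫_{δ₀}^{∞} dτ/(τ·[Φ⁻¹(τ)]^{1/(n−1)}) = ∞ for some δ₀ > Φ(0). Then for every x₀ ∈ ∂D and every d₀ ∈ (0, sup_{z∈D} |z−x₀|), ∫₀^{d₀} dρ/‖Q‖_{n−1}(x₀,ρ) = ∞. -/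
open MeasureTheory Metric Set
open scoped ENNReal NNReal

/-- `‖Q‖_{n-1}(x₀,ρ) = (∫_{S(x₀,ρ)} Q^{n-1} dA)^{1/(n-1)}`, the `L^{n-1}`-norm of `Q`
over the sphere `S(x₀,ρ)` with respect to the `(n-1)`-dimensional surface
(Hausdorff) measure. -/
noncomputable def sphNorm (n : ℕ) (Q : EuclideanSpace ℝ (Fin n) → ℝ≥0∞)
    (x₀ : EuclideanSpace ℝ (Fin n)) (ρ : ℝ) : ℝ≥0∞ :=
  (∫⁻ x in Metric.sphere x₀ ρ, (Q x) ^ ((n : ℝ) - 1) ∂(μH[(n : ℝ) - 1])) ^ (1 / ((n : ℝ) - 1))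

open scoped Pointwise in
theorem ball_subset_Ioo_smul_closedBall_sphere {E : Type*} [NormedAddCommGroup E]
    [NormedSpace ℝ E] (x : sphere (0 : E) 1) {r s : ℝ} (hr : r ∈ Ioc (0 : ℝ) 1)
    (hs : s ∈ Icc (1 / 4 : ℝ) (1 / 2)) :
    ball (s • (x : E)) (r / 16) ⊆
      Ioo (0 : ℝ) 1 • ((↑) '' closedBall x r : Set E) := by
  intro y hy
  obtain ⟨hr0, hr1⟩ := hr
  obtain ⟨hs0, hs1⟩ := hs
  have hx : ‖(x : E)‖ = 1 := by simp
  have hsx : ‖s • (x : E)‖ = s := by rw [norm_smul, hx, mul_one, Real.norm_of_nonneg (by linarith)]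
  rw [mem_ball, dist_eq_norm] at hy
  have hdiff : |‖y‖ - s| ≤ ‖y - s • (x : E)‖ := by
    simpa [hsx] using abs_norm_sub_norm_le y (s • (x : E))
  obtain ⟨h1, h2⟩ := abs_le.1 (hdiff.trans hy.le)
  have hy0 : 0 < ‖y‖ := by linarith
  have hy1 : ‖y‖ < 1 := by linarith
  have hu : ‖y‖⁻¹ • y ∈ sphere (0 : E) 1 := by
    simp [norm_smul, inv_mul_cancel₀ hy0.ne']
  refine ⟨‖y‖, ⟨hy0, hy1⟩, ‖y‖⁻¹ • y, ⟨⟨_, hu⟩, ?_, rfl⟩, smul_inv_smul₀ hy0.ne' y⟩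
  rw [mem_closedBall, Subtype.dist_eq, dist_eq_norm]
  have hmul : s * ‖‖y‖⁻¹ • y - (x : E)‖ ≤ r / 8 := by
    have e : s • (‖y‖⁻¹ • y - (x : E)) = (s - ‖y‖) • (‖y‖⁻¹ • y) + (y - s • (x : E)) := by
      rw [sub_smul, smul_inv_smul₀ hy0.ne', smul_sub]; abel
    calc s * ‖‖y‖⁻¹ • y - (x : E)‖ = ‖s • (‖y‖⁻¹ • y - (x : E))‖ := by
          rw [norm_smul, Real.norm_of_nonneg (by linarith)]
      _ ≤ ‖(s - ‖y‖) • (‖y‖⁻¹ • y)‖ + ‖y - s • (x : E)‖ := by rw [e]; exact norm_add_le _ _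
      _ = |‖y‖ - s| + ‖y - s • (x : E)‖ := by
          rw [norm_smul, mem_sphere_zero_iff_norm.1 hu, mul_one, Real.norm_eq_abs, abs_sub_comm]
      _ ≤ r / 8 := by linarith
  nlinarith [norm_nonneg (‖y‖⁻¹ • y - (x : E))]

open scoped Pointwise in
theorem ofReal_rpow_le_toSphere_closedBall {E : Type*} [NormedAddCommGroup E]
    [NormedSpace ℝ E] [MeasurableSpace E] [BorelSpace E] [FiniteDimensional ℝ E]
    (μ : Measure E) [μ.IsAddHaarMeasure] (x : sphere (0 : E) 1) {r : ℝ}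
    (hr : r ∈ Ioc (0 : ℝ) 1) :
    ENNReal.ofReal r ^ ((Module.finrank ℝ E : ℝ) - 1) ≤
      16 ^ Module.finrank ℝ E / μ (ball 0 1) * μ.toSphere (closedBall x r) := by
  have hnontriv : Nontrivial E := ⟨⟨x, 0, ne_of_apply_ne Norm.norm (by simp)⟩⟩
  obtain ⟨hr0, hr1⟩ := id hr
  set n := Module.finrank ℝ E
  have hnpos : 0 < n := Module.finrank_pos
  have hx : ‖(x : E)‖ = 1 := by simp
  set N : ℕ := ⌈1 / r⌉₊
  have hN : 1 / r ≤ N := Nat.le_ceil _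
  have hm0 : μ (ball (0 : E) 1) ≠ 0 := (measure_ball_pos μ _ one_pos).ne'
  have hm1 : μ (ball (0 : E) 1) ≠ ∞ := measure_ball_lt_top.ne
  let c : Fin N → E := fun k => (1 / 4 + k * (r / 8)) • (x : E)
  have hsub : (⋃ k, ball (c k) (r / 16)) ⊆
      Ioo (0 : ℝ) 1 • ((↑) '' closedBall x r : Set E) := by
    refine iUnion_subset fun k => ball_subset_Ioo_smul_closedBall_sphere x hr ?_
    have hk : (k : ℝ) < 1 / r := Nat.lt_ceil.1 k.2
    have hkr : (k : ℝ) * r < 1 := (lt_div_iff₀ hr0).1 hk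
    have : 0 ≤ (k : ℝ) * r := by positivity
    constructor <;> linarith
  have hdisj : Pairwise (Function.onFun Disjoint fun k => ball (c k) (r / 16)) := by
    intro i j hij
    refine ball_disjoint_ball ?_
    have hij' : (1 : ℝ) ≤ |(i : ℝ) - j| := by
      have : (i : ℤ) - j ≠ 0 := by
        intro h; exact hij (Fin.ext (by omega))
      exact_mod_cast Int.one_le_abs this
    have : dist (c i) (c j) = |(i : ℝ) - j| * (r / 8) := by
      rw [dist_eq_norm, ← sub_smul, norm_smul, hx, mul_one, Real.norm_eq_abs,
        add_sub_add_left_eq_sub, ← sub_mul, abs_mul, abs_of_pos (show 0 < r / 8 by positivity)]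
    rw [this]
    nlinarith
  have hvol : N * (ENNReal.ofReal ((r / 16) ^ n) * μ (ball 0 1)) ≤
      μ.toSphere (closedBall x r) := by
    calc N * (ENNReal.ofReal ((r / 16) ^ n) * μ (ball 0 1))
        = ∑' k : Fin N, μ (ball (c k) (r / 16)) := by
          simp [Measure.addHaar_ball_of_pos μ _ (show 0 < r / 16 by positivity), tsum_fintype, n]
      _ ≤ μ (⋃ k, ball (c k) (r / 16)) :=
          tsum_meas_le_meas_iUnion_of_disjoint μ (fun _ => measurableSet_ball) hdisj
      _ ≤ μ (Ioo (0 : ℝ) 1 • ((↑) '' closedBall x r : Set E)) := measure_mono hsub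
      _ ≤ n * μ (Ioo (0 : ℝ) 1 • ((↑) '' closedBall x r : Set E)) :=
          le_mul_of_one_le_left' (by exact_mod_cast hnpos)
      _ = _ := (μ.toSphere_apply' isClosed_closedBall.measurableSet).symm
  have hpow : ENNReal.ofReal r ^ ((n : ℝ) - 1) ≤ 16 ^ n * (N * ENNReal.ofReal ((r / 16) ^ n)) := by
    have e : ENNReal.ofReal r ^ ((n : ℝ) - 1) = ENNReal.ofReal (r ^ (n - 1)) := by
      rw [← Nat.cast_pred hnpos, ENNReal.rpow_natCast, ENNReal.ofReal_pow hr0.le]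
    have e2 : (16 : ℝ≥0∞) ^ n * (N * ENNReal.ofReal ((r / 16) ^ n)) =
        ENNReal.ofReal (16 ^ n * (N * (r / 16) ^ n)) := by
      rw [ENNReal.ofReal_mul (by positivity), ENNReal.ofReal_mul (by positivity),
        ENNReal.ofReal_pow (p := 16) (by norm_num), ENNReal.ofReal_natCast, ENNReal.ofReal_ofNat]
    rw [e, e2]
    refine ENNReal.ofReal_le_ofReal ?_
    have h1 : (16 : ℝ) ^ n * (N * (r / 16) ^ n) = N * r ^ n := by
      rw [div_pow]; field_simp
    rw [h1, ← Nat.sub_add_cancel hnpos, pow_succ, Nat.add_sub_cancel]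
    have h2 : 1 ≤ N * r := (div_le_iff₀ hr0).1 hN
    nlinarith [pow_pos hr0 (n - 1)]
  calc ENNReal.ofReal r ^ ((n : ℝ) - 1)
      ≤ 16 ^ n * (N * ENNReal.ofReal ((r / 16) ^ n)) := hpow
    _ = 16 ^ n / μ (ball 0 1) * (N * (ENNReal.ofReal ((r / 16) ^ n) * μ (ball 0 1))) := by
        rw [ENNReal.div_eq_inv_mul]
        conv_lhs => rw [← one_mul (16 ^ n * _), ← ENNReal.inv_mul_cancel hm0 hm1]
        ring
    _ ≤ _ := by gcongr

theorem hausdorffMeasure_le_of_isOpen {X : Type*} [MetricSpace X]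
    [SecondCountableTopology X] [MeasurableSpace X] [BorelSpace X] (σ : Measure X)
    {d : ℝ} (hd : 0 ≤ d) {C : ℝ≥0∞}
    (hball : ∀ x : X, ∀ r ∈ Ioc (0 : ℝ) 1,
      ENNReal.ofReal r ^ d ≤ C * σ (closedBall x r))
    {A U : Set X} (hAU : A ⊆ U) (hU : IsOpen U) :
    μH[d] A ≤ 10 ^ d * C * σ U := by
  have key : ∀ k : ℕ, ∃ (u : Set X) (r : X → ℝ), u.Countable ∧
      (∀ x ∈ u, 0 < r x ∧ r x ≤ 1 / (k + 1) ∧ closedBall x (r x) ⊆ U) ∧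
      (u.PairwiseDisjoint fun x => closedBall x (r x)) ∧
      A ⊆ ⋃ x : u, closedBall (x : X) (5 * r x) := by
    intro k
    have hr : ∀ x ∈ A, ∃ r : ℝ, 0 < r ∧ r ≤ 1 / (k + 1) ∧ closedBall x r ⊆ U := by
      intro x hx
      obtain ⟨ε, hε, hεU⟩ := Metric.nhds_basis_closedBall.mem_iff.1 (hU.mem_nhds (hAU hx))
      refine ⟨min ε (1 / (k + 1)), lt_min hε (by positivity), min_le_right _ _,
        (closedBall_subset_closedBall (min_le_left _ _)).trans hεU⟩
    choose! r hr using hr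
    obtain ⟨u, huA, hdisj, hcov⟩ :=
      Vitali.exists_disjoint_subfamily_covering_enlargement_closedBall A (fun x => x) r
        (1 / (k + 1)) (fun x hx => (hr x hx).2.1) 5 (by norm_num)
    refine ⟨u, r, ?_, fun x hx => hr x (huA hx), hdisj, ?_⟩
    · refine hdisj.countable_of_nonempty_interior fun x hx => ?_
      exact ⟨x, ball_subset_interior_closedBall (mem_ball_self (hr x (huA hx)).1)⟩
    · intro a ha
      obtain ⟨b, hb, hab⟩ := hcov a ha
      exact mem_iUnion.2 ⟨⟨b, hb⟩, hab (mem_closedBall_self (hr a ha).1.le)⟩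
  choose u r hcount hr hdisj hcov using key
  have : ∀ k, Countable (u k) := fun k => (hcount k).to_subtype
  have hdiam : ∀ k (x : u k), ediam (closedBall (x : X) (5 * r k x)) ≤
      10 * ENNReal.ofReal (r k x) := by
    intro k x
    rw [← Metric.closedEBall_ofReal (by linarith [(hr k x x.2).1])]
    refine ediam_closedEBall_le.trans_eq ?_
    rw [ENNReal.ofReal_mul (by norm_num), ← mul_assoc]
    norm_num
  have hlim : Filter.Tendsto (fun k : ℕ => 10 * ENNReal.ofReal (1 / ((k : ℝ) + 1)))
      Filter.atTop (nhds 0) := by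
    have h := ENNReal.Tendsto.const_mul (a := 10)
      (ENNReal.tendsto_ofReal (tendsto_one_div_add_atTop_nhds_zero_nat (𝕜 := ℝ)))
      (Or.inr (by norm_num))
    simpa using h
  refine (Measure.hausdorffMeasure_le_liminf_tsum (ι := fun k => u k) d A _ hlim
    (fun k x => closedBall (x : X) (5 * r k x))
    (Filter.Eventually.of_forall fun k x => (hdiam k x).trans ?_)
    (Filter.Eventually.of_forall hcov)).trans ?_
  · gcongr
    exact (hr k x x.2).2.1
  refine Filter.liminf_le_of_frequently_le' (Filter.Eventually.of_forall fun k => ?_).frequently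
  calc ∑' x : u k, ediam (closedBall (x : X) (5 * r k x)) ^ d
      ≤ ∑' x : u k, 10 ^ d * C * σ (closedBall (x : X) (r k x)) := by
        refine ENNReal.tsum_le_tsum fun x => ?_
        obtain ⟨h0, h1, -⟩ := hr k x x.2
        have h1' : r k x ≤ 1 := h1.trans ((div_le_one (by positivity)).2 (by simp))
        calc _ ≤ (10 * ENNReal.ofReal (r k x)) ^ d := ENNReal.rpow_le_rpow (hdiam k x) hd
          _ = 10 ^ d * ENNReal.ofReal (r k x) ^ d := ENNReal.mul_rpow_of_nonneg _ _ hd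
          _ ≤ 10 ^ d * (C * σ (closedBall (x : X) (r k x))) := by
            gcongr; exact hball x _ ⟨h0, h1'⟩
          _ = _ := (mul_assoc _ _ _).symm
    _ = 10 ^ d * C * ∑' x : u k, σ (closedBall (x : X) (r k x)) := ENNReal.tsum_mul_left
    _ ≤ 10 ^ d * C * σ (⋃ x : u k, closedBall (x : X) (r k x)) := by
        gcongr
        exact tsum_meas_le_meas_iUnion_of_disjoint σ (fun _ => isClosed_closedBall.measurableSet)
          fun x y hxy => hdisj k x.2 y.2 (Subtype.coe_injective.ne hxy)
    _ ≤ _ := by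
        gcongr
        exact iUnion_subset fun x => (hr k x x.2).2.2

/-- If `σ` gives every ball of radius `r ≤ 1` mass at least a multiple of `r ^ d`, then the
`d`-dimensional Hausdorff measure is bounded by a multiple of `σ`. -/
theorem hausdorffMeasure_le_of_le_measure_closedBall {X : Type*} [MetricSpace X]
    [SecondCountableTopology X] [MeasurableSpace X] [BorelSpace X] (σ : Measure X)
    [IsFiniteMeasure σ] {d : ℝ} (hd : 0 ≤ d) {C : ℝ≥0∞} (hC : C ≠ ∞)
    (hball : ∀ x : X, ∀ r ∈ Ioc (0 : ℝ) 1,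
      ENNReal.ofReal r ^ d ≤ C * σ (closedBall x r)) (A : Set X) :
    μH[d] A ≤ 10 ^ d * C * σ A := by
  have hK : 10 ^ d * C ≠ ∞ := ENNReal.mul_ne_top (ENNReal.rpow_ne_top_of_nonneg hd (by norm_num)) hC
  rw [mul_comm, ← ENNReal.div_le_iff_le_mul (Or.inr (measure_ne_top _ _)) (Or.inl hK)]
  by_contra! h
  obtain ⟨U, hAU, hU, hlt⟩ := A.exists_isOpen_lt_of_lt _ h
  refine hlt.not_ge ?_
  rw [ENNReal.div_le_iff_le_mul (Or.inr (measure_ne_top _ _)) (Or.inl hK), mul_comm]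
  exact hausdorffMeasure_le_of_isOpen σ hd hball hAU hU

theorem exists_hausdorffMeasure_sphere_le_toSphere {E : Type*} [NormedAddCommGroup E]
    [NormedSpace ℝ E] [MeasurableSpace E] [BorelSpace E] [FiniteDimensional ℝ E] [Nontrivial E]
    (μ : Measure E) [μ.IsAddHaarMeasure] :
    ∃ C : ℝ≥0∞, C ≠ 0 ∧ C ≠ ∞ ∧ ∀ A : Set (sphere (0 : E) 1),
      μH[(Module.finrank ℝ E : ℝ) - 1] A ≤ C * μ.toSphere A := by
  have hd : (0 : ℝ) ≤ (Module.finrank ℝ E : ℝ) - 1 :=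
    sub_nonneg.2 (by exact_mod_cast (Module.finrank_pos : 0 < Module.finrank ℝ E))
  have hm0 : μ (ball (0 : E) 1) ≠ 0 := (measure_ball_pos μ _ one_pos).ne'
  have hm1 : μ (ball (0 : E) 1) ≠ ∞ := measure_ball_lt_top.ne
  have hC : (16 : ℝ≥0∞) ^ Module.finrank ℝ E / μ (ball 0 1) ≠ ∞ :=
    ENNReal.div_ne_top (by finiteness) hm0
  have : ProperSpace E := FiniteDimensional.proper_real E
  refine ⟨_, mul_ne_zero ?_ ?_, ENNReal.mul_ne_top ?_ hC,
    hausdorffMeasure_le_of_le_measure_closedBall μ.toSphere hd hC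
      fun x r hr => ofReal_rpow_le_toSphere_closedBall μ x hr⟩
  · exact (ENNReal.rpow_pos (by norm_num) (by norm_num)).ne'
  · exact ENNReal.div_ne_zero.2 ⟨by simp, hm1⟩
  · exact ENNReal.rpow_ne_top_of_nonneg hd (by norm_num)

/-- Integration in polar coordinates. -/
theorem lintegral_polar {E : Type*} [NormedAddCommGroup E]
    [NormedSpace ℝ E] [MeasurableSpace E] [BorelSpace E] [FiniteDimensional ℝ E] [Nontrivial E]
    (μ : Measure E) [μ.IsAddHaarMeasure] {F : E → ℝ≥0∞} (hF : Measurable F) :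
    ∫⁻ ρ in Ioi (0 : ℝ), ENNReal.ofReal (ρ ^ (Module.finrank ℝ E - 1)) *
      ∫⁻ θ, F (ρ • (θ : E)) ∂μ.toSphere = ∫⁻ x, F x ∂μ := by
  have hFm : Measurable fun p : sphere (0 : E) 1 × Ioi (0 : ℝ) => F ((p.2 : ℝ) • (p.1 : E)) := by
    refine hF.comp (Continuous.measurable ?_)
    fun_prop
  symm
  calc ∫⁻ x, F x ∂μ = ∫⁻ x in ({0}ᶜ : Set E), F x ∂μ := by
        rw [restrict_compl_singleton]
    _ = ∫⁻ x : ({0}ᶜ : Set E), F x ∂(μ.comap (↑)) :=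
        (lintegral_subtype_comap (measurableSet_singleton _).compl _).symm
    _ = ∫⁻ p, F ((p.2 : ℝ) • (p.1 : E))
          ∂(μ.toSphere.prod (Measure.volumeIoiPow (Module.finrank ℝ E - 1))) := by
        rw [← (Measure.measurePreserving_homeomorphUnitSphereProd μ).lintegral_comp hFm]
        refine lintegral_congr fun x => ?_
        congr 1
        have hx : ‖(x : E)‖ ≠ 0 := norm_ne_zero_iff.2 x.2
        simp [smul_inv_smul₀ hx]
    _ = ∫⁻ ρ, ∫⁻ θ, F ((ρ : ℝ) • (θ : E)) ∂μ.toSphere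
          ∂(Measure.volumeIoiPow (Module.finrank ℝ E - 1)) := lintegral_prod_symm' _ hFm
    _ = ∫⁻ ρ : Ioi (0 : ℝ), ENNReal.ofReal ((ρ : ℝ) ^ (Module.finrank ℝ E - 1)) *
          ∫⁻ θ, F ((ρ : ℝ) • (θ : E)) ∂μ.toSphere ∂(Measure.comap Subtype.val volume) := by
        rw [Measure.volumeIoiPow, lintegral_withDensity_eq_lintegral_mul _ (by fun_prop)
          (Measurable.lintegral_prod_left' hFm)]
        rfl
    _ = _ := lintegral_subtype_comap measurableSet_Ioi (fun ρ : ℝ =>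
          ENNReal.ofReal (ρ ^ (Module.finrank ℝ E - 1)) *
          ∫⁻ θ, F (ρ • (θ : E)) ∂μ.toSphere)

theorem setLIntegral_sphere_hausdorffMeasure_le {E : Type*} [NormedAddCommGroup E]
    [NormedSpace ℝ E] [MeasurableSpace E] [BorelSpace E] {d : ℝ} (hd : 0 ≤ d)
    (σ : Measure (sphere (0 : E) 1)) {C : ℝ≥0∞} (hσ : ∀ A, μH[d] A ≤ C * σ A)
    {F : E → ℝ≥0∞} (hF : Measurable F) (x₀ : E) {ρ : ℝ} (hρ : 0 < ρ) :
    ∫⁻ x in sphere x₀ ρ, F x ∂μH[d] ≤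
      C * ENNReal.ofReal ρ ^ d * ∫⁻ θ, F (x₀ + ρ • (θ : E)) ∂σ := by
  let f : sphere (0 : E) 1 → E := fun θ => x₀ + ρ • (θ : E)
  have hf : Measurable f := by
    refine Continuous.measurable ?_
    fun_prop
  have hlip : LipschitzWith ρ.toNNReal f := by
    refine LipschitzWith.of_dist_le_mul fun a b => ?_
    simp only [f, dist_add_left, dist_smul₀, Real.norm_of_nonneg hρ.le,
      Real.coe_toNNReal _ hρ.le, Subtype.dist_eq, le_refl]
  have hle : (μH[d]).restrict (sphere x₀ ρ) ≤
      (C * ENNReal.ofReal ρ ^ d) • σ.map f := by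
    refine Measure.le_iff.2 fun A hA => ?_
    rw [Measure.restrict_apply hA, Measure.smul_apply, Measure.map_apply hf hA, smul_eq_mul]
    have hsub : A ∩ sphere x₀ ρ ⊆ f '' (f ⁻¹' A) := by
      rintro y ⟨hyA, hy⟩
      have hy' : ‖y - x₀‖ = ρ := by rwa [mem_sphere, dist_eq_norm] at hy
      have hfy : x₀ + ρ • (ρ⁻¹ • (y - x₀)) = y := by
        rw [smul_inv_smul₀ hρ.ne']; abel
      refine ⟨⟨ρ⁻¹ • (y - x₀), ?_⟩, ?_, hfy⟩
      · simp [norm_smul, hy', abs_of_pos hρ, inv_mul_cancel₀ hρ.ne']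
      · simpa only [mem_preimage, f, hfy] using hyA
    calc μH[d] (A ∩ sphere x₀ ρ) ≤ μH[d] (f '' (f ⁻¹' A)) := measure_mono hsub
      _ ≤ (ρ.toNNReal : ℝ≥0∞) ^ d * μH[d] (f ⁻¹' A) := hlip.hausdorffMeasure_image_le hd _
      _ ≤ (ρ.toNNReal : ℝ≥0∞) ^ d * (C * σ (f ⁻¹' A)) := by gcongr; exact hσ _
      _ = C * ENNReal.ofReal ρ ^ d * σ (f ⁻¹' A) := by rw [ENNReal.ofReal]; ring
  refine (lintegral_mono' hle le_rfl).trans_eq ?_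
  rw [lintegral_smul_measure, lintegral_map hF hf, smul_eq_mul]

theorem lintegral_indicator_ball_polar {E : Type*} [NormedAddCommGroup E]
    [NormedSpace ℝ E] [MeasurableSpace E] [BorelSpace E] [FiniteDimensional ℝ E] [Nontrivial E]
    (μ : Measure E) [μ.IsAddHaarMeasure] {F : E → ℝ≥0∞} (hF : Measurable F) (x₀ : E) (R : ℝ) :
    ∫⁻ ρ in Ioi (0 : ℝ), ENNReal.ofReal (ρ ^ (Module.finrank ℝ E - 1)) *
      (Iio R).indicator (fun ρ => ∫⁻ θ, F (x₀ + ρ • (θ : E)) ∂μ.toSphere) ρ =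
      ∫⁻ x in ball x₀ R, F x ∂μ := by
  have hF' : Measurable ((ball x₀ R).indicator F) := hF.indicator measurableSet_ball
  rw [← lintegral_indicator measurableSet_ball, ← lintegral_add_left_eq_self _ x₀,
    ← lintegral_polar μ (F := fun x => (ball x₀ R).indicator F (x₀ + x))
      (hF'.comp (measurable_const_add x₀))]
  refine setLIntegral_congr_fun measurableSet_Ioi fun ρ hρ => ?_
  have hmem : ∀ θ : sphere (0 : E) 1, x₀ + ρ • (θ : E) ∈ ball x₀ R ↔ ρ < R := fun θ => by
    simp [norm_smul, abs_of_pos (mem_Ioi.1 hρ)]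
  by_cases h : ρ < R <;> simp [indicator, -mem_ball, hmem, h]

/-- Convexity of `Φ` between `0` and `t`, with the coefficient of `Φ 0` bounded by `1`. -/
def StarConvexAtZero (Φ : ℝ≥0∞ → ℝ≥0∞) : Prop :=
  ∀ a : ℝ≥0, a ≤ 1 → ∀ t : ℝ≥0∞, Φ (a * t) ≤ a * Φ t + Φ 0

theorem genInv_ne_zero {Φ : ℝ≥0∞ → ℝ≥0∞} (hΦmono : Monotone Φ)
    (hΦ : StarConvexAtZero Φ) {t : ℝ≥0∞} (ht0 : t ≠ 0) (ht : Φ t ≠ ∞) {c : ℝ≥0∞}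
    (hc : Φ 0 < c) : genInv Φ c ≠ 0 := by
  obtain ⟨ε, hε, hεc⟩ := ENNReal.lt_iff_exists_add_pos_lt.1 hc
  obtain ⟨a, ha, haε⟩ := ENNReal.exists_nnreal_pos_mul_lt ht
    (ENNReal.coe_ne_zero.2 hε.ne')
  set b : ℝ≥0 := min a 1
  have hb : 0 < b := lt_min ha one_pos
  have hlt : Φ (b * t) < c := calc
    Φ (b * t) ≤ b * Φ t + Φ 0 := hΦ b (min_le_right _ _) t
    _ ≤ a * Φ t + Φ 0 := by gcongr; exact min_le_left _ _
    _ ≤ ε + Φ 0 := by gcongr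
    _ < c := by rwa [add_comm]
  have hle : (b : ℝ≥0∞) * t ≤ genInv Φ c := le_sInf fun s hs =>
    le_of_lt (hΦmono.reflect_lt (hlt.trans_le hs))
  exact (lt_of_lt_of_le (pos_iff_ne_zero.2 (mul_ne_zero (by exact_mod_cast hb.ne') ht0)) hle).ne'

theorem mul_le_of_le_apply {Φ : ℝ≥0∞ → ℝ≥0∞} (hΦ : StarConvexAtZero Φ) {τ s t : ℝ≥0∞}
    (hτ : τ ≠ ∞) (h0 : 2 * Φ 0 ≤ τ) (ht : τ ≤ Φ t) (hs : s ≠ ∞) :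
    s * τ ≤ t * τ + 2 * t * Φ s := by
  rcases le_total s t with hst | hst
  · exact le_add_right (by gcongr)
  lift s to ℝ≥0 using hs
  lift t to ℝ≥0 using ne_top_of_le_ne_top ENNReal.coe_ne_top hst
  rcases eq_or_ne s 0 with rfl | hs0
  · simp
  have hst' : t ≤ s := by exact_mod_cast hst
  have hmul : ((t / s : ℝ≥0) : ℝ≥0∞) * (s : ℝ≥0∞) = t := by
    rw [← ENNReal.coe_mul, div_mul_cancel₀ _ hs0]
  have hconv : τ ≤ (t / s : ℝ≥0) * Φ s + Φ 0 := by
    have := hΦ (t / s) (div_le_one_of_le₀ hst' zero_le) s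
    rw [hmul] at this
    exact ht.trans this
  have h2 : τ + τ ≤ 2 * ((t / s : ℝ≥0) * Φ s) + τ := calc
    τ + τ = 2 * τ := (two_mul τ).symm
    _ ≤ 2 * ((t / s : ℝ≥0) * Φ s + Φ 0) := by gcongr
    _ = 2 * ((t / s : ℝ≥0) * Φ s) + 2 * Φ 0 := mul_add _ _ _
    _ ≤ _ := by gcongr
  have h3 : τ ≤ 2 * ((t / s : ℝ≥0) * Φ s) := (ENNReal.add_le_add_iff_right hτ).1 h2
  calc (s : ℝ≥0∞) * τ ≤ s * (2 * ((t / s : ℝ≥0) * Φ s)) := by gcongr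
    _ = 2 * ((t / s : ℝ≥0) * s) * Φ s := by ring
    _ = 2 * t * Φ s := by rw [hmul]
    _ ≤ _ := le_add_self

/-- A weak form of the Jensen inequality: a bound on `∫ Φ(f)` bounds `∫ f` by a multiple of
`Φ⁻¹`. -/
theorem lintegral_le_mul_genInv {Φ : ℝ≥0∞ → ℝ≥0∞} (hΦ : StarConvexAtZero Φ)
    (hΦmono : Monotone Φ) {X : Type*} [MeasurableSpace X] (σ : Measure X) [IsFiniteMeasure σ]
    {f : X → ℝ≥0∞} (hf : Measurable f) (hftop : ∀ x, f x ≠ ∞) {τ : ℝ≥0∞}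
    (hτ : τ ≠ ∞) (hτ0 : τ ≠ 0) (h0 : 2 * Φ 0 ≤ τ) (hle : ∫⁻ x, Φ (f x) ∂σ ≤ τ) :
    ∫⁻ x, f x ∂σ ≤ (σ univ + 2) * genInv Φ τ := by
  have hS : σ univ + 2 ≠ ∞ := by finiteness
  rw [mul_comm, ← ENNReal.div_le_iff_le_mul (Or.inl (by simp)) (Or.inl hS)]
  refine le_sInf fun t ht => ?_
  rw [ENNReal.div_le_iff_le_mul (Or.inl (by simp)) (Or.inl hS),
    ← ENNReal.mul_le_mul_iff_left hτ0 hτ]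
  calc (∫⁻ x, f x ∂σ) * τ = ∫⁻ x, f x * τ ∂σ := (lintegral_mul_const _ hf).symm
    _ ≤ ∫⁻ x, (t * τ + 2 * t * Φ (f x)) ∂σ :=
        lintegral_mono fun x => mul_le_of_le_apply hΦ hτ h0 ht (hftop x)
    _ = t * τ * σ univ + 2 * t * ∫⁻ x, Φ (f x) ∂σ := by
        rw [lintegral_add_left measurable_const, lintegral_const,
          lintegral_const_mul _ (show Measurable fun x => Φ (f x) from hΦmono.measurable.comp hf)]
    _ ≤ t * τ * σ univ + 2 * t * τ := by gcongr
    _ = t * (σ univ + 2) * τ := by ring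

theorem image_inv_pow_Ioo {R : ℝ} (hR : 0 < R) {m : ℕ} (hm : m ≠ 0) :
    (fun ρ : ℝ => (ρ ^ m)⁻¹) '' Ioo 0 R = Ioi (R ^ m)⁻¹ := by
  ext τ
  constructor
  · rintro ⟨ρ, ⟨h0, h1⟩, rfl⟩
    exact inv_strictAnti₀ (pow_pos h0 m) (pow_lt_pow_left₀ h1 h0.le hm)
  · intro hτ
    have hτ0 : 0 < τ := (inv_pos.2 (pow_pos hR m)).trans hτ
    have hroot : (τ⁻¹ ^ (m : ℝ)⁻¹) ^ m = τ⁻¹ := Real.rpow_inv_natCast_pow (inv_pos.2 hτ0).le hm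
    refine ⟨τ⁻¹ ^ (m : ℝ)⁻¹, ⟨Real.rpow_pos_of_pos (inv_pos.2 hτ0) _, ?_⟩, ?_⟩
    · refine lt_of_pow_lt_pow_left₀ m hR.le ?_
      rw [hroot]
      exact inv_lt_of_inv_lt₀ (pow_pos hR m) hτ
    · simp only [hroot, inv_inv]

theorem lintegral_Ioi_inv_mul_eq {R : ℝ} (hR : 0 < R) {m : ℕ} (hm : m ≠ 0) (w : ℝ → ℝ≥0∞) :
    ∫⁻ τ in Ioi (R ^ m)⁻¹, ENNReal.ofReal τ⁻¹ * w τ =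
      m * ∫⁻ ρ in Ioo 0 R, ENNReal.ofReal ρ⁻¹ * w (ρ ^ m)⁻¹ := by
  have hinj : InjOn (fun ρ : ℝ => (ρ ^ m)⁻¹) (Ioo 0 R) := fun a ha b hb hab =>
    (pow_left_inj₀ ha.1.le hb.1.le hm).1 (inv_injective hab)
  rw [← image_inv_pow_Ioo hR hm, lintegral_image_eq_lintegral_abs_deriv_mul measurableSet_Ioo
    (fun ρ hρ => ((hasDerivAt_pow m ρ).fun_inv (pow_ne_zero m hρ.1.ne')).hasDerivWithinAt) hinj,
    ← lintegral_const_mul' _ _ (by simp)]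
  refine setLIntegral_congr_fun measurableSet_Ioo fun ρ hρ => ?_
  have hρ0 : 0 < ρ := hρ.1
  rw [← mul_assoc, ← mul_assoc, ← ENNReal.ofReal_mul (abs_nonneg _), ← ENNReal.ofReal_natCast,
    ← ENNReal.ofReal_mul (Nat.cast_nonneg m), inv_inv]
  congr 2
  rw [abs_div, abs_neg, abs_of_pos (show 0 < (m : ℝ) * ρ ^ (m - 1) by positivity),
    abs_of_pos (show 0 < (ρ ^ m) ^ 2 by positivity)]
  obtain ⟨k, rfl⟩ := Nat.exists_eq_succ_of_ne_zero hm
  simp only [Nat.succ_eq_add_one, Nat.add_sub_cancel]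
  field_simp
  ring

/-- Divergence of `∫ w(τ) dτ/τ` at infinity survives the substitution `τ = ρ ^ (-(n + 1))` and the
removal of the set of those `ρ` where a function with `∫ ρ ^ (n - 1) G(ρ) dρ < ∞` exceeds
`ρ ^ (-(n + 1))`. -/
theorem setLIntegral_inv_mul_eq_top {n : ℕ} (hn : 0 < n) {δ R : ℝ} (hδ : 0 < δ) (hR : 0 < R)
    (hδR : δ ≤ (R ^ (n + 1))⁻¹) {w : ℝ → ℝ≥0∞} (hw : AntitoneOn w (Ici δ))
    (hwδ : w δ ≠ ∞) (hdiv : ∫⁻ τ in Ioi δ, ENNReal.ofReal τ⁻¹ * w τ = ∞)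
    {G : ℝ → ℝ≥0∞} (hG : Measurable G)
    (hGint : ∫⁻ ρ in Ioi (0 : ℝ), ENNReal.ofReal (ρ ^ (n - 1)) * (Iio R).indicator G ρ ≠ ∞) :
    ∫⁻ ρ in Ioo 0 R ∩ {ρ | G ρ ≤ ENNReal.ofReal (ρ ^ (n + 1))⁻¹},
      ENNReal.ofReal ρ⁻¹ * w (ρ ^ (n + 1))⁻¹ = ∞ := by
  set T := (R ^ (n + 1))⁻¹
  have htail : ∫⁻ τ in Ioi T, ENNReal.ofReal τ⁻¹ * w τ = ∞ := by
    by_contra hne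
    rw [← Ioc_union_Ioi_eq_Ioi hδR] at hdiv
    have hhead : ∫⁻ τ in Ioc δ T, ENNReal.ofReal τ⁻¹ * w τ ≤
        ∫⁻ _ in Ioc δ T, ENNReal.ofReal δ⁻¹ * w δ := by
      refine setLIntegral_mono' measurableSet_Ioc fun τ hτ => ?_
      have hwle : w τ ≤ w δ := hw self_mem_Ici hτ.1.le hτ.1.le
      have hinv : τ⁻¹ ≤ δ⁻¹ := inv_anti₀ hδ hτ.1.le
      gcongr
    have hfin : ∫⁻ _ in Ioc δ T, ENNReal.ofReal δ⁻¹ * w δ ≠ ∞ := by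
      rw [setLIntegral_const, Real.volume_Ioc]
      finiteness
    have := lintegral_union_le (μ := volume) (fun τ => ENNReal.ofReal τ⁻¹ * w τ) (Ioc δ T) (Ioi T)
    rw [hdiv, top_le_iff] at this
    exact ENNReal.add_ne_top.2 ⟨ne_top_of_le_ne_top hfin hhead, hne⟩ this
  rw [lintegral_Ioi_inv_mul_eq hR n.succ_ne_zero] at htail
  have hfull : ∫⁻ ρ in Ioo 0 R, ENNReal.ofReal ρ⁻¹ * w (ρ ^ (n + 1))⁻¹ = ∞ := by
    by_contra hne
    exact ENNReal.mul_ne_top (by simp) hne htail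
  have hgood : MeasurableSet {ρ | G ρ ≤ ENNReal.ofReal (ρ ^ (n + 1))⁻¹} :=
    measurableSet_le hG (by fun_prop)
  by_contra hne
  rw [← lintegral_inter_add_sdiff _ (Ioo 0 R) hgood] at hfull
  refine ENNReal.add_ne_top.2 ⟨hne, ?_⟩ hfull
  have hbad : ∫⁻ ρ in Ioo 0 R \ {ρ | G ρ ≤ ENNReal.ofReal (ρ ^ (n + 1))⁻¹},
      ENNReal.ofReal ρ⁻¹ * w (ρ ^ (n + 1))⁻¹ ≤
      ∫⁻ ρ in Ioi (0 : ℝ), w δ * ENNReal.ofReal R *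
        (ENNReal.ofReal (ρ ^ (n - 1)) * (Iio R).indicator G ρ) := by
    refine le_trans (setLIntegral_mono' (measurableSet_Ioo.diff hgood) fun ρ hρ => ?_)
      (lintegral_mono_set fun ρ hρ => hρ.1.1)
    obtain ⟨⟨h0, h1⟩, hρG⟩ := hρ
    rw [mem_ofPred_eq, not_le] at hρG
    rw [indicator_of_mem (show ρ ∈ Iio R from h1)]
    have hTρ : δ ≤ (ρ ^ (n + 1))⁻¹ :=
      hδR.trans (inv_anti₀ (pow_pos h0 _) (pow_le_pow_left₀ h0.le h1.le _))
    have hwle : w (ρ ^ (n + 1))⁻¹ ≤ w δ := hw self_mem_Ici hTρ hTρ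
    have hinv : ENNReal.ofReal ρ⁻¹ ≤ ENNReal.ofReal R * (ENNReal.ofReal (ρ ^ (n - 1)) * G ρ) := calc
      ENNReal.ofReal ρ⁻¹ = ENNReal.ofReal ρ * (ENNReal.ofReal (ρ ^ (n - 1)) *
          ENNReal.ofReal (ρ ^ (n + 1))⁻¹) := by
        rw [← ENNReal.ofReal_mul (by positivity), ← ENNReal.ofReal_mul h0.le]
        congr 1
        obtain ⟨k, rfl⟩ := Nat.exists_eq_succ_of_ne_zero hn.ne'
        simp only [Nat.succ_eq_add_one, Nat.add_sub_cancel]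
        field_simp
        ring
      _ ≤ _ := by gcongr
    calc ENNReal.ofReal ρ⁻¹ * w (ρ ^ (n + 1))⁻¹
        ≤ (ENNReal.ofReal R * (ENNReal.ofReal (ρ ^ (n - 1)) * G ρ)) * w δ := by gcongr
      _ = _ := by ring
  refine ne_top_of_le_ne_top ?_ hbad
  rw [lintegral_const_mul' _ _ (by finiteness)]
  exact ENNReal.mul_ne_top (by finiteness) hGint

/-- Let `n ≥ 2`, `D` a bounded domain in `ℝⁿ`, `Q : D → (0,∞)`
measurable, extended by `0` outside `D`, and `Φ : [0,∞] → [0,∞]` convex and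
non-decreasing, with `∫_D Φ(Q^{n-1}) dm < ∞` and
`∫_{δ₀}^∞ dτ/(τ [Φ⁻¹(τ)]^{1/(n-1)}) = ∞` for some `δ₀ > Φ(0)`.  Then for every
`x₀ ∈ ∂D` and every `d₀ ∈ (0, sup_{z∈D}|z-x₀|)`, `∫₀^{d₀} dρ/‖Q‖_{n-1}(x₀,ρ) = ∞`. -/
theorem stmt_11 (n : ℕ) (hn : 2 ≤ n)
    (D : Set (EuclideanSpace ℝ (Fin n))) (hD : IsOpen D) (hDconn : IsConnected D)
    (hDbdd : Bornology.IsBounded D)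
    (Q : EuclideanSpace ℝ (Fin n) → ℝ≥0∞) (hQmeas : Measurable Q)
    (hQD : ∀ x ∈ D, 0 < Q x ∧ Q x < ∞) (hQ0 : ∀ x ∉ D, Q x = 0)
    (Φ : ℝ≥0∞ → ℝ≥0∞) (hΦmono : Monotone Φ)
    (hΦconv : ∀ (a : ℝ≥0), a ≤ 1 → ∀ t₁ t₂ : ℝ≥0∞,
      Φ (a • t₁ + (1 - a) • t₂) ≤ a • Φ t₁ + (1 - a) • Φ t₂)
    (hint : (∫⁻ y in D, Φ ((Q y) ^ ((n : ℝ) - 1))) ≠ ∞)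
    (δ₀ : ℝ) (hδ₀ : Φ 0 < ENNReal.ofReal δ₀)
    (hdiv : ∫⁻ τ in Set.Ioi δ₀,
      (ENNReal.ofReal τ * (genInv Φ (ENNReal.ofReal τ)) ^ (1 / ((n : ℝ) - 1)))⁻¹ = ∞) :
    ∀ x₀ ∈ frontier D, ∀ d₀ : ℝ, 0 < d₀ → (∃ z ∈ D, d₀ < dist z x₀) →
      ∫⁻ ρ in Set.Ioo (0 : ℝ) d₀, (sphNorm n Q x₀ ρ)⁻¹ = ∞ := by
  intro x₀ _ d₀ hd₀ _
  set p : ℝ := (n : ℝ) - 1 with hp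
  have hn0 : 0 < n := by omega
  have hp0 : 0 < p := by
    have : (2 : ℝ) ≤ n := by exact_mod_cast hn
    linarith
  have : Nonempty (Fin n) := ⟨⟨0, hn0⟩⟩
  have hΦ : StarConvexAtZero Φ := by
    intro a ha t
    calc Φ (a * t) = Φ (a • t + (1 - a) • 0) := by simp [ENNReal.smul_def]
      _ ≤ a • Φ t + (1 - a) • Φ 0 := hΦconv a ha t 0
      _ ≤ a * Φ t + Φ 0 := by
        rw [ENNReal.smul_def, ENNReal.smul_def, smul_eq_mul, smul_eq_mul]
        gcongr
        exact mul_le_of_le_one_left' (by exact_mod_cast tsub_le_self)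
  have hΦ0 : Φ 0 ≠ ∞ := hδ₀.ne_top
  have hδpos : 0 < δ₀ := ENNReal.ofReal_pos.1 (zero_le.trans_lt hδ₀)
  have hQtop : ∀ x, Q x ^ p ≠ ∞ := fun x => by
    refine ENNReal.rpow_ne_top_of_nonneg hp0.le ?_
    by_cases hx : x ∈ D
    · exact (hQD x hx).2.ne
    · simp [hQ0 x hx]
  have hQp : Measurable fun x => Q x ^ p := hQmeas.pow_const p
  have hH : Measurable fun x => Φ (Q x ^ p) := hΦmono.measurable.comp hQp
  obtain ⟨t, ht0, ht⟩ : ∃ t, t ≠ 0 ∧ Φ t ≠ ∞ := by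
    by_contra! hall
    refine hint ?_
    rw [setLIntegral_congr_fun hD.measurableSet (g := fun _ => ∞) fun x hx =>
      hall _ (ENNReal.rpow_pos (hQD x hx).1 (hQD x hx).2.ne).ne', setLIntegral_const,
      ENNReal.top_mul (hD.measure_pos volume hDconn.nonempty).ne']
  set w : ℝ → ℝ≥0∞ := fun τ => (genInv Φ (ENNReal.ofReal τ) ^ (1 / p))⁻¹ with hw
  have hwanti : Antitone w := fun a b hab => ENNReal.inv_le_inv.2 <|
    ENNReal.rpow_le_rpow (genInv_mono Φ (ENNReal.ofReal_le_ofReal hab)) (by positivity)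
  have hwδ : w δ₀ ≠ ∞ := ENNReal.inv_ne_top.2 <| by
    have := genInv_ne_zero hΦmono hΦ ht0 ht hδ₀
    rw [Ne, ENNReal.rpow_eq_zero_iff_of_pos (by positivity)]
    exact this
  have hwdiv : ∫⁻ τ in Ioi δ₀, ENNReal.ofReal τ⁻¹ * w τ = ∞ := by
    rw [← hdiv]
    refine setLIntegral_congr_fun measurableSet_Ioi fun τ hτ => ?_
    have hτ0 : 0 < τ := hδpos.trans hτ
    simp only [hw]
    rw [ENNReal.mul_inv (Or.inl (ENNReal.ofReal_pos.2 hτ0).ne') (Or.inl ENNReal.ofReal_ne_top),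
      ENNReal.ofReal_inv_of_pos hτ0]
  obtain ⟨C, hC0, hC, hCσ⟩ := exists_hausdorffMeasure_sphere_le_toSphere
    (volume : Measure (EuclideanSpace ℝ (Fin n)))
  rw [finrank_euclideanSpace_fin, ← hp] at hCσ
  set σ := (volume : Measure (EuclideanSpace ℝ (Fin n))).toSphere
  set δ₁ : ℝ := max δ₀ (2 * (Φ 0).toReal)
  have hδ₁ : 0 < δ₁ := hδpos.trans_le (le_max_left _ _)
  obtain ⟨R, hR, hR1, hRd, hRδ⟩ : ∃ R : ℝ, 0 < R ∧ R ≤ 1 ∧ R ≤ d₀ ∧ R ≤ δ₁⁻¹ :=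
    ⟨min 1 (min d₀ δ₁⁻¹), by positivity, min_le_left _ _,
      (min_le_right _ _).trans (min_le_left _ _), (min_le_right _ _).trans (min_le_right _ _)⟩
  have hδR : δ₁ ≤ (R ^ (n + 1))⁻¹ := by
    rw [le_inv_comm₀ hδ₁ (by positivity)]
    exact (pow_le_of_le_one hR.le hR1 n.succ_ne_zero).trans hRδ
  set G : ℝ → ℝ≥0∞ := fun ρ => ∫⁻ θ, Φ (Q (x₀ + ρ • (θ : EuclideanSpace ℝ (Fin n))) ^ p) ∂σ
  have hGmeas : Measurable G := by
    refine Measurable.lintegral_prod_right'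
      (f := fun q : ℝ × sphere (0 : EuclideanSpace ℝ (Fin n)) 1 =>
        Φ (Q (x₀ + q.1 • (q.2 : EuclideanSpace ℝ (Fin n))) ^ p))
      (hH.comp (Continuous.measurable ?_))
    fun_prop
  have hGint : ∫⁻ ρ in Ioi (0 : ℝ), ENNReal.ofReal (ρ ^ (n - 1)) * (Iio R).indicator G ρ ≠ ∞ := by
    have hpolar := lintegral_indicator_ball_polar volume hH x₀ R
    rw [finrank_euclideanSpace_fin] at hpolar
    rw [hpolar]
    have hle : ∫⁻ x in ball x₀ R, Φ (Q x ^ p) ≤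
        ∫⁻ x, (D.indicator (fun x => Φ (Q x ^ p)) x + (ball x₀ R).indicator (fun _ => Φ 0) x) := by
      rw [← lintegral_indicator measurableSet_ball]
      refine lintegral_mono fun x => ?_
      by_cases hx : x ∈ ball x₀ R <;> by_cases hxD : x ∈ D <;>
        simp [hx, hxD, hQ0, ENNReal.zero_rpow_of_pos hp0]
    refine ne_top_of_le_ne_top ?_ hle
    rw [lintegral_add_left (hH.indicator hD.measurableSet), lintegral_indicator hD.measurableSet,
      lintegral_indicator measurableSet_ball, setLIntegral_const]
    exact ENNReal.add_ne_top.2 ⟨hint, ENNReal.mul_ne_top hΦ0 measure_ball_lt_top.ne⟩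
  have hmain := setLIntegral_inv_mul_eq_top hn0 hδpos hR ((le_max_left _ _).trans hδR)
    (hwanti.antitoneOn _) hwδ hwdiv hGmeas hGint
  set A : ℝ≥0∞ := (C * (σ univ + 2)) ^ (1 / p) with hA
  have hAtop : A ≠ ∞ := ENNReal.rpow_ne_top_of_nonneg (by positivity)
    (ENNReal.mul_ne_top hC (by finiteness))
  have hA0 : A ≠ 0 := by
    rw [hA, Ne, ENNReal.rpow_eq_zero_iff_of_pos (by positivity)]
    exact mul_ne_zero hC0 (by simp)
  have hgood : ∀ ρ ∈ Ioo 0 R ∩ {ρ | G ρ ≤ ENNReal.ofReal (ρ ^ (n + 1))⁻¹},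
      A⁻¹ * (ENNReal.ofReal ρ⁻¹ * w (ρ ^ (n + 1))⁻¹) ≤ (sphNorm n Q x₀ ρ)⁻¹ := by
    rintro ρ ⟨⟨h0, h1⟩, hρG⟩
    set τ : ℝ := (ρ ^ (n + 1))⁻¹
    have hτpos : 0 < τ := by positivity
    have hδτ : δ₁ ≤ τ :=
      hδR.trans (inv_anti₀ (pow_pos h0 _) (pow_le_pow_left₀ h0.le h1.le _))
    have h2 : 2 * Φ 0 ≤ ENNReal.ofReal τ := by
      rw [← ENNReal.ofReal_toReal hΦ0, ← ENNReal.ofReal_ofNat, ← ENNReal.ofReal_mul (by norm_num)]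
      exact ENNReal.ofReal_le_ofReal ((le_max_right _ _).trans hδτ)
    have hK := lintegral_le_mul_genInv hΦ hΦmono σ
      (f := fun θ => Q (x₀ + ρ • (θ : EuclideanSpace ℝ (Fin n))) ^ p)
      (hQp.comp (Continuous.measurable (by fun_prop))) (fun θ => hQtop _)
      ENNReal.ofReal_ne_top (ENNReal.ofReal_pos.2 hτpos).ne' h2 hρG
    have hsph : sphNorm n Q x₀ ρ ≤
        A * (ENNReal.ofReal ρ * genInv Φ (ENNReal.ofReal τ) ^ (1 / p)) := calc
      sphNorm n Q x₀ ρ ≤ (C * ENNReal.ofReal ρ ^ p *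
          ((σ univ + 2) * genInv Φ (ENNReal.ofReal τ))) ^ (1 / p) := by
        refine ENNReal.rpow_le_rpow ?_ (by positivity)
        refine (setLIntegral_sphere_hausdorffMeasure_le hp0.le σ hCσ hQp x₀ h0).trans ?_
        gcongr
      _ = (C * (σ univ + 2) * (ENNReal.ofReal ρ ^ p *
          genInv Φ (ENNReal.ofReal τ))) ^ (1 / p) := by ring_nf
      _ = _ := by
        rw [ENNReal.mul_rpow_of_nonneg _ _ (by positivity), ← hA,
          ENNReal.mul_rpow_of_nonneg _ _ (by positivity), ← ENNReal.rpow_mul,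
          mul_one_div_cancel hp0.ne', ENNReal.rpow_one]
    refine le_trans (le_of_eq ?_) (ENNReal.inv_le_inv.2 hsph)
    have hρ' := (ENNReal.ofReal_pos.2 h0).ne'
    rw [ENNReal.mul_inv (Or.inl hA0) (Or.inl hAtop),
      ENNReal.mul_inv (Or.inl hρ') (Or.inl ENNReal.ofReal_ne_top), ENNReal.ofReal_inv_of_pos h0]
  have hgm : MeasurableSet (Ioo 0 R ∩ {ρ | G ρ ≤ ENNReal.ofReal (ρ ^ (n + 1))⁻¹}) :=
    measurableSet_Ioo.inter (measurableSet_le hGmeas (by fun_prop))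
  refine top_le_iff.1 ?_
  calc ∞ = A⁻¹ * ∫⁻ ρ in Ioo 0 R ∩ {ρ | G ρ ≤ ENNReal.ofReal (ρ ^ (n + 1))⁻¹},
        ENNReal.ofReal ρ⁻¹ * w (ρ ^ (n + 1))⁻¹ := by
        rw [hmain, ENNReal.mul_top (ENNReal.inv_ne_zero.2 hAtop)]
    _ ≤ ∫⁻ ρ in Ioo 0 R ∩ {ρ | G ρ ≤ ENNReal.ofReal (ρ ^ (n + 1))⁻¹},
        A⁻¹ * (ENNReal.ofReal ρ⁻¹ * w (ρ ^ (n + 1))⁻¹) := lintegral_const_mul_le _ _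
    _ ≤ ∫⁻ ρ in Ioo 0 R ∩ {ρ | G ρ ≤ ENNReal.ofReal (ρ ^ (n + 1))⁻¹},
        (sphNorm n Q x₀ ρ)⁻¹ := setLIntegral_mono' hgm hgood
    _ ≤ _ := lintegral_mono_set
        (inter_subset_left.trans (Ioo_subset_Ioo_right hRd))
end
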